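/- Let n > 0. No Σₙ-definable extension of Robinson arithmetic Q that is consistent together with the set Πₙ-Th(ℕ) of all true Πₙ-sentences is Πₙ-deciding: if T ⊇ Q has its set of (Gödel numbers of) axioms definable in ℕ by a Σₙ-formula and T + Πₙ-Th(ℕ) is consistent, then there exists a Πₙ-sentence γ with T ⊬ γ and T ⊬ ¬γ. -/

import Mathlib

/-!
Formalization of results from "Gödel–Rosser's Incompleteness Theorems for
non-RE Theories" (Salehi & Seraji).

We work in the first-order language of arithmetic `{0, S, +, ×, ≤}` with the
standard model `ℕ`.  Provability `T ⊢ φ` is rendered as the semantic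
consequence `T ⊨ᵇ φ` of Mathlib's model theory library, which by the Gödel
completeness theorem coincides with provability in first-order logic.
-/

open FirstOrder Language BoundedFormula

namespace GRNonRE

/-- Function symbols of arithmetic: `0`, `S`, `+`, `×`. -/
inductive ArithFunc : ℕ → Type
  | zero : ArithFunc 0
  | succ : ArithFunc 1
  | add  : ArithFunc 2
  | mul  : ArithFunc 2

/-- The relation symbol `≤`. -/
inductive ArithRel : ℕ → Type
  | le : ArithRel 2

/-- The first-order language of arithmetic `{0, S, +, ×, ≤}`. -/
def LA : FirstOrder.Language := ⟨ArithFunc, ArithRel⟩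

/-- The standard model `ℕ`. -/
instance : LA.Structure ℕ where
  funMap {_} f := match f with
    | ArithFunc.zero => fun _ => 0
    | ArithFunc.succ => fun v => v 0 + 1
    | ArithFunc.add  => fun v => v 0 + v 1
    | ArithFunc.mul  => fun v => v 0 * v 1
  RelMap {_} r := match r with
    | ArithRel.le => fun v => v 0 ≤ v 1

def zeroT {α : Type} : LA.Term α := Term.func ArithFunc.zero ![]
def succT {α : Type} (t : LA.Term α) : LA.Term α := Term.func ArithFunc.succ ![t]
def addT {α : Type} (t s : LA.Term α) : LA.Term α := Term.func ArithFunc.add ![t, s]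
def mulT {α : Type} (t s : LA.Term α) : LA.Term α := Term.func ArithFunc.mul ![t, s]

/-- The atomic formula `t ≤ s`. -/
def leF {α : Type} {n : ℕ} (t s : LA.Term (α ⊕ Fin n)) : LA.BoundedFormula α n :=
  BoundedFormula.rel ArithRel.le ![t, s]

/-- The numeral `m̄ = S (S ⋯ (S 0))` representing `m : ℕ`. -/
def numeral : ℕ → LA.Term Empty
  | 0 => zeroT
  | n + 1 => succT (numeral n)

instance : Encodable (Σ n, LA.Functions n) :=
  ⟨fun f => match f with
    | ⟨_, ArithFunc.zero⟩ => 0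
    | ⟨_, ArithFunc.succ⟩ => 1
    | ⟨_, ArithFunc.add⟩ => 2
    | ⟨_, ArithFunc.mul⟩ => 3,
   fun n => match n with
    | 0 => some ⟨0, ArithFunc.zero⟩
    | 1 => some ⟨1, ArithFunc.succ⟩
    | 2 => some ⟨2, ArithFunc.add⟩
    | 3 => some ⟨2, ArithFunc.mul⟩
    | _ => none,
   by rintro ⟨n, f⟩; cases f <;> rfl⟩

instance : Encodable (Σ n, LA.Relations n) :=
  ⟨fun _ => 0,
   fun n => match n with
    | 0 => some ⟨2, ArithRel.le⟩
    | _ => none,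
   by rintro ⟨n, r⟩; cases r; rfl⟩

/-- A standard Gödel numbering of formulas, obtained from Mathlib's structural
encoding of bounded formulas as lists of symbols. -/
def godel {k : ℕ} (φ : LA.BoundedFormula Empty k) : ℕ :=
  Encodable.encode φ.listEncode

/-- Lift a term in context `k` to context `k + 1`. -/
def liftT {k : ℕ} (t : LA.Term (Empty ⊕ Fin k)) : LA.Term (Empty ⊕ Fin (k + 1)) :=
  t.relabel (Sum.map id Fin.castSucc)

/-- The class `Σ₀ = Π₀ = Δ₀` of bounded formulas: built from atomic formulas by
Boolean connectives (`⊥` and `⟹`, from which `∼`, `⊓`, `⊔` are definable) and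
bounded universal quantification `∀ x ≤ t, φ` (bounded existential
quantification `∃ x ≤ t, φ` is expressible as `∼ ∀ x ≤ t, ∼φ`). -/
inductive Delta0 : ∀ {k : ℕ}, LA.BoundedFormula Empty k → Prop
  | falsum {k : ℕ} : Delta0 (⊥ : LA.BoundedFormula Empty k)
  | equal {k : ℕ} (t₁ t₂ : LA.Term (Empty ⊕ Fin k)) : Delta0 (t₁ =' t₂)
  | le {k : ℕ} (t₁ t₂ : LA.Term (Empty ⊕ Fin k)) : Delta0 (leF t₁ t₂)
  | imp {k : ℕ} {φ ψ : LA.BoundedFormula Empty k} :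
      Delta0 φ → Delta0 ψ → Delta0 (φ ⟹ ψ)
  | bdall {k : ℕ} (t : LA.Term (Empty ⊕ Fin k)) {φ : LA.BoundedFormula Empty (k + 1)} :
      Delta0 φ → Delta0 ((leF (&(Fin.last k)) (liftT t) ⟹ φ).all)

mutual
  /-- The classes `Σₙ` of the arithmetical hierarchy: `Σ₀` is the class of
  bounded formulas, and `Σ_{n+1}` contains `Πₙ` and is closed under `⊓`, `⊔`,
  existential quantification and bounded universal quantification. -/
  inductive IsSigma : ℕ → ∀ {k : ℕ}, LA.BoundedFormula Empty k → Prop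
    | ofDelta0 {k : ℕ} {φ : LA.BoundedFormula Empty k} : Delta0 φ → IsSigma 0 φ
    | ofPi {n k : ℕ} {φ : LA.BoundedFormula Empty k} :
        IsPi n φ → IsSigma (n + 1) φ
    | ex {n k : ℕ} {φ : LA.BoundedFormula Empty (k + 1)} :
        IsSigma (n + 1) φ → IsSigma (n + 1) φ.ex
    | inf {n k : ℕ} {φ ψ : LA.BoundedFormula Empty k} :
        IsSigma (n + 1) φ → IsSigma (n + 1) ψ → IsSigma (n + 1) (φ ⊓ ψ)
    | sup {n k : ℕ} {φ ψ : LA.BoundedFormula Empty k} :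
        IsSigma (n + 1) φ → IsSigma (n + 1) ψ → IsSigma (n + 1) (φ ⊔ ψ)
    | bdall {n k : ℕ} (t : LA.Term (Empty ⊕ Fin k))
        {φ : LA.BoundedFormula Empty (k + 1)} :
        IsSigma (n + 1) φ → IsSigma (n + 1) ((leF (&(Fin.last k)) (liftT t) ⟹ φ).all)

  /-- The classes `Πₙ` of the arithmetical hierarchy: `Π₀` is the class of
  bounded formulas, and `Π_{n+1}` contains `Σₙ` and is closed under `⊓`, `⊔`,
  universal quantification and bounded existential quantification. -/
  inductive IsPi : ℕ → ∀ {k : ℕ}, LA.BoundedFormula Empty k → Prop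
    | ofDelta0 {k : ℕ} {φ : LA.BoundedFormula Empty k} : Delta0 φ → IsPi 0 φ
    | ofSigma {n k : ℕ} {φ : LA.BoundedFormula Empty k} :
        IsSigma n φ → IsPi (n + 1) φ
    | all {n k : ℕ} {φ : LA.BoundedFormula Empty (k + 1)} :
        IsPi (n + 1) φ → IsPi (n + 1) φ.all
    | inf {n k : ℕ} {φ ψ : LA.BoundedFormula Empty k} :
        IsPi (n + 1) φ → IsPi (n + 1) ψ → IsPi (n + 1) (φ ⊓ ψ)
    | sup {n k : ℕ} {φ ψ : LA.BoundedFormula Empty k} :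
        IsPi (n + 1) φ → IsPi (n + 1) ψ → IsPi (n + 1) (φ ⊔ ψ)
    | bdex {n k : ℕ} (t : LA.Term (Empty ⊕ Fin k))
        {φ : LA.BoundedFormula Empty (k + 1)} :
        IsPi (n + 1) φ → IsPi (n + 1) ((leF (&(Fin.last k)) (liftT t) ⊓ φ).ex)
end

/-- `T ⊢ φ`: by the Gödel completeness theorem, provability of the sentence `φ`
from the theory `T` coincides with the semantic consequence relation. -/
def Proves (T : LA.Theory) (φ : LA.Sentence) : Prop := T ⊨ᵇ φ

/-- Consistency of a theory. -/
def Consistent (T : LA.Theory) : Prop := ¬ Proves T ⊥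

/-- `ψ(m̄)`: the result of substituting the numeral `m̄` for the free variable
of a formula `ψ(x)` with one free variable. -/
def subst1 (ψ : LA.BoundedFormula Empty 1) (m : ℕ) : LA.Sentence :=
  ψ.toFormula.subst fun _ => numeral m

/-- `n`-consistency: there is no formula `ψ(x) ∈ Π_{n-1}` such that `T ⊢ ¬ψ(m̄)`
for every numeral `m̄` (`m ∈ ℕ`) and yet `T ⊢ ∃x ψ(x)`.
(`0`-consistency is ordinary consistency.) -/
def NCon : ℕ → LA.Theory → Prop
  | 0, T => Consistent T
  | n + 1, T => ¬ ∃ ψ : LA.BoundedFormula Empty 1, IsPi n ψ ∧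
      (∀ m : ℕ, Proves T (∼(subst1 ψ m))) ∧ Proves T ψ.ex

/-- The axioms of Robinson arithmetic `Q`:
`Sx ≠ 0`, `Sx = Sy → x = y`, `x ≠ 0 → ∃y x = Sy`, `x + 0 = x`,
`x + Sy = S(x + y)`, `x·0 = 0`, `x·Sy = x·y + x`, `x ≤ y ↔ ∃z z + x = y`. -/
def QTheory : LA.Theory :=
  { ∀' ∼(succT (&0) =' zeroT),
    ∀' ∀' ((succT (&0) =' succT (&1)) ⟹ (&0 =' &1)),
    ∀' (∼(&0 =' zeroT) ⟹ ∃' (&0 =' succT (&1))),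
    ∀' (addT (&0) zeroT =' &0),
    ∀' ∀' (addT (&0) (succT (&1)) =' succT (addT (&0) (&1))),
    ∀' (mulT (&0) zeroT =' zeroT),
    ∀' ∀' (mulT (&0) (succT (&1)) =' addT (mulT (&0) (&1)) (&0)),
    ((leF (&0) (&1) ⇔ ∃' (addT (&2) (&0) =' (&1)) : LA.BoundedFormula Empty 2)).alls }

/-- `T` is an extension of Robinson arithmetic `Q` (i.e. `T` proves `Q`). -/
def ExtendsQ (T : LA.Theory) : Prop := ∀ φ ∈ QTheory, Proves T φ

/-- `Πₙ-Th(ℕ)`: the set of `Πₙ`-sentences true in the standard model. -/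
def PiTh (n : ℕ) : LA.Theory := {φ | IsPi n φ ∧ ℕ ⊨ φ}

/-- Soundness: every theorem of `T` is true in `ℕ`. -/
def Sound (T : LA.Theory) : Prop := ∀ φ : LA.Sentence, Proves T φ → ℕ ⊨ φ

/-- `Σₙ`-soundness: every `Σₙ`-sentence provable in `T` is true in `ℕ`. -/
def SigmaSound (n : ℕ) (T : LA.Theory) : Prop :=
  ∀ φ : LA.Sentence, IsSigma n φ → Proves T φ → ℕ ⊨ φ

/-- A formula `Ψ(x)` with one free variable defines the set `A ⊆ ℕ` in `ℕ`. -/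
def Defines (Ψ : LA.BoundedFormula Empty 1) (A : Set ℕ) : Prop :=
  ∀ m : ℕ, m ∈ A ↔ Ψ.Realize (fun e => Empty.elim e) ![m]

/-- `A ⊆ ℕ` is definable in `ℕ` by a `Σₙ`-formula. -/
def SigmaDefinable (n : ℕ) (A : Set ℕ) : Prop := ∃ Ψ, IsSigma n Ψ ∧ Defines Ψ A

/-- `A ⊆ ℕ` is definable in `ℕ` by a `Πₙ`-formula. -/
def PiDefinable (n : ℕ) (A : Set ℕ) : Prop := ∃ Ψ, IsPi n Ψ ∧ Defines Ψ A

/-- The set of Gödel numbers of the axioms of `T`. -/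
def axiomCodes (T : LA.Theory) : Set ℕ := {m | ∃ φ ∈ T, godel φ = m}

/-- The set of Gödel numbers of the theorems of `T` (its deductive closure). -/
def theoremCodes (T : LA.Theory) : Set ℕ := {m | ∃ φ, Proves T φ ∧ godel φ = m}

/-! ### Substitution of terms for the variables of a formula -/

/-- Simultaneous substitution of terms for the variables of a term. -/
def substTerm {k l : ℕ} (σ : Fin k → LA.Term (Empty ⊕ Fin l)) (t : LA.Term (Empty ⊕ Fin k)) :
    LA.Term (Empty ⊕ Fin l) :=
  t.subst (Sum.elim Empty.elim σ)

/-- Extend a substitution by the identity on a new last variable. -/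
def extendSubst {k l : ℕ} (σ : Fin k → LA.Term (Empty ⊕ Fin l)) :
    Fin (k + 1) → LA.Term (Empty ⊕ Fin (l + 1)) :=
  Fin.snoc (fun i => liftT (σ i)) (&(Fin.last l))

/-- Simultaneous substitution of terms for the variables of a formula. -/
def substFormula : ∀ {k l : ℕ}, (Fin k → LA.Term (Empty ⊕ Fin l)) →
    LA.BoundedFormula Empty k → LA.BoundedFormula Empty l
  | _, _, _, .falsum => .falsum
  | _, _, σ, .equal t s => .equal (substTerm σ t) (substTerm σ s)
  | _, _, σ, .rel R ts => .rel R fun i => substTerm σ (ts i)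
  | _, _, σ, .imp φ ψ => .imp (substFormula σ φ) (substFormula σ ψ)
  | _, _, σ, .all φ => .all (substFormula (extendSubst σ) φ)

theorem substTerm_liftT {k l : ℕ} (σ : Fin k → LA.Term (Empty ⊕ Fin l))
    (t : LA.Term (Empty ⊕ Fin k)) :
    substTerm (extendSubst σ) (liftT t) = liftT (substTerm σ t) := by
  induction t with
  | var x =>
    rcases x with x | x
    · exact x.elim
    · simp [substTerm, liftT, extendSubst, Term.subst, Term.relabel]
  | func f ts ih =>
    simp only [substTerm, liftT, Term.subst, Term.relabel] at ih ⊢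
    congr 1
    exact funext ih

theorem substFormula_leF {k l : ℕ} (σ : Fin k → LA.Term (Empty ⊕ Fin l))
    (t s : LA.Term (Empty ⊕ Fin k)) :
    substFormula σ (leF t s) = leF (substTerm σ t) (substTerm σ s) := by
  simp only [leF, substFormula]
  congr 1
  funext i
  refine Fin.cases rfl (fun j => ?_) i
  rw [Subsingleton.elim j 0]
  rfl

theorem substFormula_leF_last {k l : ℕ} (σ : Fin k → LA.Term (Empty ⊕ Fin l))
    (t : LA.Term (Empty ⊕ Fin k)) :
    substFormula (extendSubst σ) (leF (&(Fin.last k)) (liftT t)) =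
      leF (&(Fin.last l)) (liftT (substTerm σ t)) := by
  rw [substFormula_leF, substTerm_liftT]
  congr 1
  simp [substTerm, extendSubst]

theorem Delta0.subst {k : ℕ} {φ : LA.BoundedFormula Empty k} (h : Delta0 φ) :
    ∀ {l : ℕ} (σ : Fin k → LA.Term (Empty ⊕ Fin l)), Delta0 (substFormula σ φ) := by
  induction h with
  | falsum => exact fun _ => .falsum
  | equal t s => exact fun _ => .equal _ _
  | le t s => exact fun σ => substFormula_leF σ t s ▸ .le _ _
  | imp _ _ ih₁ ih₂ => exact fun σ => .imp (ih₁ σ) (ih₂ σ)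
  | bdall t _ ih =>
    intro l σ
    have := Delta0.bdall (substTerm σ t) (ih (extendSubst σ))
    rwa [← substFormula_leF_last] at this

mutual
  theorem IsSigma.subst {n k : ℕ} {φ : LA.BoundedFormula Empty k} (h : IsSigma n φ)
      {l : ℕ} (σ : Fin k → LA.Term (Empty ⊕ Fin l)) : IsSigma n (substFormula σ φ) := by
    match h with
    | .ofDelta0 h => exact .ofDelta0 (h.subst σ)
    | .ofPi h => exact .ofPi (IsPi.subst h σ)
    | .ex h => exact .ex (IsSigma.subst h (extendSubst σ))
    | .inf h₁ h₂ => exact .inf (IsSigma.subst h₁ σ) (IsSigma.subst h₂ σ)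
    | .sup h₁ h₂ => exact .sup (IsSigma.subst h₁ σ) (IsSigma.subst h₂ σ)
    | .bdall t h =>
      have := IsSigma.bdall (substTerm σ t) (IsSigma.subst h (extendSubst σ))
      rwa [← substFormula_leF_last] at this

  theorem IsPi.subst {n k : ℕ} {φ : LA.BoundedFormula Empty k} (h : IsPi n φ)
      {l : ℕ} (σ : Fin k → LA.Term (Empty ⊕ Fin l)) : IsPi n (substFormula σ φ) := by
    match h with
    | .ofDelta0 h => exact .ofDelta0 (h.subst σ)
    | .ofSigma h => exact .ofSigma (IsSigma.subst h σ)
    | .all h => exact .all (IsPi.subst h (extendSubst σ))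
    | .inf h₁ h₂ => exact .inf (IsPi.subst h₁ σ) (IsPi.subst h₂ σ)
    | .sup h₁ h₂ => exact .sup (IsPi.subst h₁ σ) (IsPi.subst h₂ σ)
    | .bdex t h =>
      have := IsPi.bdex (substTerm σ t) (IsPi.subst h (extendSubst σ))
      rwa [← substFormula_leF_last] at this
end

mutual
  theorem IsSigma.succ {n k : ℕ} {φ : LA.BoundedFormula Empty k} (h : IsSigma n φ) :
      IsSigma (n + 1) φ := by
    match h with
    | .ofDelta0 h => exact .ofPi (.ofDelta0 h)
    | .ofPi h => exact .ofPi (IsPi.succ h)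
    | .ex h => exact .ex (IsSigma.succ h)
    | .inf h₁ h₂ => exact .inf (IsSigma.succ h₁) (IsSigma.succ h₂)
    | .sup h₁ h₂ => exact .sup (IsSigma.succ h₁) (IsSigma.succ h₂)
    | .bdall t h => exact .bdall t (IsSigma.succ h)

  theorem IsPi.succ {n k : ℕ} {φ : LA.BoundedFormula Empty k} (h : IsPi n φ) :
      IsPi (n + 1) φ := by
    match h with
    | .ofDelta0 h => exact .ofSigma (.ofDelta0 h)
    | .ofSigma h => exact .ofSigma (IsSigma.succ h)
    | .all h => exact .all (IsPi.succ h)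
    | .inf h₁ h₂ => exact .inf (IsPi.succ h₁) (IsPi.succ h₂)
    | .sup h₁ h₂ => exact .sup (IsPi.succ h₁) (IsPi.succ h₂)
    | .bdex t h => exact .bdex t (IsPi.succ h)
end

theorem Delta0.isPi {n k : ℕ} {φ : LA.BoundedFormula Empty k} (h : Delta0 φ) : IsPi n φ := by
  induction n with
  | zero => exact .ofDelta0 h
  | succ n ih => exact ih.succ

/-! ### Operations of an arithmetical structure -/

section Operations

variable {M : Type} [LA.Structure M]

variable (M) in
/-- The interpretation of `0`. -/
abbrev zeroM : M := Structure.funMap (L := LA) ArithFunc.zero ![]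

/-- The interpretation of `S`. -/
abbrev succM (a : M) : M := Structure.funMap (L := LA) ArithFunc.succ ![a]

/-- The interpretation of `+`. -/
abbrev addM (a b : M) : M := Structure.funMap (L := LA) ArithFunc.add ![a, b]

/-- The interpretation of `×`. -/
abbrev mulM (a b : M) : M := Structure.funMap (L := LA) ArithFunc.mul ![a, b]

/-- The interpretation of `≤`. -/
abbrev leM (a b : M) : Prop := Structure.RelMap (L := LA) ArithRel.le ![a, b]

end Operations

/-! ### Realization of substituted and lifted expressions -/

section Realize

variable {M : Type} [LA.Structure M]

theorem realize_liftT {k : ℕ} (t : LA.Term (Empty ⊕ Fin k)) (e : Empty → M) (v : Fin k → M)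
    (a : M) :
    (liftT t).realize (Sum.elim e (Fin.snoc v a)) = t.realize (Sum.elim e v) := by
  rw [liftT, Term.realize_relabel]
  congr 1
  funext x
  rcases x with x | x
  · exact x.elim
  · simp

theorem realize_substTerm {k l : ℕ} (σ : Fin k → LA.Term (Empty ⊕ Fin l))
    (t : LA.Term (Empty ⊕ Fin k)) (e : Empty → M) (v : Fin l → M) :
    (substTerm σ t).realize (Sum.elim e v) =
      t.realize (Sum.elim e fun i => (σ i).realize (Sum.elim e v)) := by
  rw [substTerm, Term.realize_subst]
  congr 1
  funext x
  rcases x with x | x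
  · exact x.elim
  · rfl

theorem realize_substFormula {k : ℕ} (φ : LA.BoundedFormula Empty k) (e : Empty → M) :
    ∀ {l : ℕ} (σ : Fin k → LA.Term (Empty ⊕ Fin l)) (v : Fin l → M),
    (substFormula σ φ).Realize e v ↔ φ.Realize e fun i => (σ i).realize (Sum.elim e v) := by
  induction φ with
  | falsum => exact fun _ _ => Iff.rfl
  | equal t s =>
    intro l σ v
    simp only [substFormula, BoundedFormula.Realize, realize_substTerm]
  | rel R ts =>
    intro l σ v
    simp only [substFormula, BoundedFormula.Realize, realize_substTerm]
  | imp φ ψ ih₁ ih₂ =>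
    intro l σ v
    simp only [substFormula, BoundedFormula.Realize, ih₁, ih₂]
  | all φ ih =>
    intro l σ v
    simp only [substFormula, BoundedFormula.Realize, ih]
    refine forall_congr' fun a => iff_of_eq (congrArg _ ?_)
    funext i
    refine Fin.lastCases ?_ (fun j => ?_) i
    · simp [extendSubst]
    · simp [extendSubst, realize_liftT]

theorem realize_leF {k : ℕ} (t s : LA.Term (Empty ⊕ Fin k)) (e : Empty → M) (v : Fin k → M) :
    (leF t s).Realize e v ↔ 
      leM (t.realize (Sum.elim e v)) (s.realize (Sum.elim e v)) := by
  simp only [leF, BoundedFormula.Realize]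
  refine iff_of_eq (congrArg _ ?_)
  funext i
  refine Fin.cases rfl (fun j => ?_) i
  rw [Subsingleton.elim j 0]
  rfl

theorem realize_bdall {k : ℕ} (t : LA.Term (Empty ⊕ Fin k))
    (φ : LA.BoundedFormula Empty (k + 1)) (e : Empty → M) (v : Fin k → M) :
    ((leF (&(Fin.last k)) (liftT t) ⟹ φ).all).Realize e v ↔
      ∀ a : M, leM a (t.realize (Sum.elim e v)) →
        φ.Realize e (Fin.snoc v a) := by
  simp [BoundedFormula.realize_all, BoundedFormula.realize_imp, realize_leF, realize_liftT]

theorem realize_bdex {k : ℕ} (t : LA.Term (Empty ⊕ Fin k))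
    (φ : LA.BoundedFormula Empty (k + 1)) (e : Empty → M) (v : Fin k → M) :
    ((leF (&(Fin.last k)) (liftT t) ⊓ φ).ex).Realize e v ↔
      ∃ a : M, leM a (t.realize (Sum.elim e v)) ∧
        φ.Realize e (Fin.snoc v a) := by
  simp [BoundedFormula.realize_ex, BoundedFormula.realize_inf, realize_leF, realize_liftT]

theorem realize_zeroT {α : Type} (e : α → M) :
    (zeroT : LA.Term α).realize e = zeroM M := by
  simp only [zeroT, Term.realize]
  congr 1
  exact Subsingleton.elim _ _

theorem realize_succT {α : Type} (e : α → M) (t : LA.Term α) :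
    (succT t).realize e = succM (t.realize e) := by
  simp only [succT, Term.realize]
  congr 1
  funext i
  rw [Subsingleton.elim i 0]
  rfl

theorem realize_addT {α : Type} (e : α → M) (t s : LA.Term α) :
    (addT t s).realize e = addM (t.realize e) (s.realize e) := by
  simp only [addT, Term.realize]
  congr 1
  funext i
  refine Fin.cases rfl (fun j => ?_) i
  rw [Subsingleton.elim j 0]
  rfl

theorem realize_mulT {α : Type} (e : α → M) (t s : LA.Term α) :
    (mulT t s).realize e = mulM (t.realize e) (s.realize e) := by
  simp only [mulT, Term.realize]
  congr 1
  funext i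
  refine Fin.cases rfl (fun j => ?_) i
  rw [Subsingleton.elim j 0]
  rfl

end Realize

/-! ### Dual formulas -/

mutual
  theorem IsSigma.exists_dual {n k : ℕ} {φ : LA.BoundedFormula Empty k} (h : IsSigma n φ) :
      ∃ ψ : LA.BoundedFormula Empty k, IsPi n ψ ∧ ∀ (M : Type) [LA.Structure M]
        (e : Empty → M) (v : Fin k → M), ψ.Realize e v ↔ ¬ φ.Realize e v := by
    match h with
    | .ofDelta0 h =>
      exact ⟨φ ⟹ ⊥, .ofDelta0 (.imp h .falsum), fun M _ e v => by simp⟩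
    | .ofPi h =>
      obtain ⟨ψ, hψ, H⟩ := IsPi.exists_dual h
      exact ⟨ψ, .ofSigma hψ, H⟩
    | .ex h =>
      obtain ⟨ψ, hψ, H⟩ := IsSigma.exists_dual h
      exact ⟨ψ.all, .all hψ, fun M _ e v => by simp [H]⟩
    | .inf h₁ h₂ =>
      obtain ⟨ψ₁, hψ₁, H₁⟩ := IsSigma.exists_dual h₁
      obtain ⟨ψ₂, hψ₂, H₂⟩ := IsSigma.exists_dual h₂
      exact ⟨ψ₁ ⊔ ψ₂, .sup hψ₁ hψ₂, fun M _ e v => by simp [H₁, H₂]; tauto⟩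
    | .sup h₁ h₂ =>
      obtain ⟨ψ₁, hψ₁, H₁⟩ := IsSigma.exists_dual h₁
      obtain ⟨ψ₂, hψ₂, H₂⟩ := IsSigma.exists_dual h₂
      exact ⟨ψ₁ ⊓ ψ₂, .inf hψ₁ hψ₂, fun M _ e v => by simp [H₁, H₂]⟩
    | .bdall t h =>
      obtain ⟨ψ, hψ, H⟩ := IsSigma.exists_dual h
      exact ⟨_, .bdex t hψ, fun M _ e v => by simp only [realize_bdall, realize_bdex, H]; simp⟩

  theorem IsPi.exists_dual {n k : ℕ} {φ : LA.BoundedFormula Empty k} (h : IsPi n φ) :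
      ∃ ψ : LA.BoundedFormula Empty k, IsSigma n ψ ∧ ∀ (M : Type) [LA.Structure M]
        (e : Empty → M) (v : Fin k → M), ψ.Realize e v ↔ ¬ φ.Realize e v := by
    match h with
    | .ofDelta0 h =>
      exact ⟨φ ⟹ ⊥, .ofDelta0 (.imp h .falsum), fun M _ e v => by simp⟩
    | .ofSigma h =>
      obtain ⟨ψ, hψ, H⟩ := IsSigma.exists_dual h
      exact ⟨ψ, .ofPi hψ, H⟩
    | .all h =>
      obtain ⟨ψ, hψ, H⟩ := IsPi.exists_dual h
      exact ⟨ψ.ex, .ex hψ, fun M _ e v => by simp [H]⟩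
    | .inf h₁ h₂ =>
      obtain ⟨ψ₁, hψ₁, H₁⟩ := IsPi.exists_dual h₁
      obtain ⟨ψ₂, hψ₂, H₂⟩ := IsPi.exists_dual h₂
      exact ⟨ψ₁ ⊔ ψ₂, .sup hψ₁ hψ₂, fun M _ e v => by simp [H₁, H₂]; tauto⟩
    | .sup h₁ h₂ =>
      obtain ⟨ψ₁, hψ₁, H₁⟩ := IsPi.exists_dual h₁
      obtain ⟨ψ₂, hψ₂, H₂⟩ := IsPi.exists_dual h₂
      exact ⟨ψ₁ ⊓ ψ₂, .inf hψ₁ hψ₂, fun M _ e v => by simp [H₁, H₂]⟩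
    | .bdex t h =>
      obtain ⟨ψ, hψ, H⟩ := IsPi.exists_dual h
      exact ⟨_, .bdall t hψ, fun M _ e v => by simp only [realize_bdall, realize_bdex, H]; simp⟩
end

/-! ### Models of Robinson arithmetic and `Σₙ`-completeness -/

section QModels

variable (M : Type) [LA.Structure M]

/-- The element of an arithmetical structure denoted by a numeral. -/
def stdElt : ℕ → M
  | 0 => zeroM M
  | n + 1 => succM (stdElt n)

theorem stdElt_nat (n : ℕ) : stdElt ℕ n = n := by
  induction n with
  | zero => rfl
  | succ n ih => exact congrArg (· + 1) ih

/-- The numeral of `m` as a term in any context. -/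
def numeralT (α : Type) : ℕ → LA.Term α
  | 0 => zeroT
  | n + 1 => succT (numeralT α n)

variable {M}

theorem realize_numeralT {α : Type} (e : α → M) (m : ℕ) :
    (numeralT α m).realize e = stdElt M m := by
  induction m with
  | zero => exact realize_zeroT e
  | succ m ih => rw [numeralT, realize_succT, ih, stdElt]

variable (M) in
/-- The semantic content of the axioms of Robinson arithmetic that concern successor, addition,
multiplication and order of standard elements. -/
structure ModelsQ : Prop where
  succ_ne_zero : ∀ a : M, succM a ≠ zeroM M
  succ_inj : ∀ a b : M, succM a = succM b → a = b
  eq_succ : ∀ a : M, a ≠ zeroM M → ∃ b : M, a = succM b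
  add_zero : ∀ a : M, addM a (zeroM M) = a
  add_succ : ∀ a b : M, addM a (succM b) = succM (addM a b)
  mul_zero : ∀ a : M, mulM a (zeroM M) = zeroM M
  mul_succ : ∀ a b : M, mulM a (succM b) = addM (mulM a b) a
  le_iff : ∀ a b : M, leM a b ↔ ∃ c : M, addM c a = b

theorem modelsQ_of_realize (h : ∀ φ ∈ QTheory, M ⊨ φ) : ModelsQ M := by
  simp only [QTheory, Set.mem_insert_iff, Set.mem_singleton_iff, forall_eq_or_imp, forall_eq,
    Sentence.Realize, Formula.Realize, BoundedFormula.realize_all,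
    BoundedFormula.realize_imp, BoundedFormula.realize_not, BoundedFormula.realize_ex,
    BoundedFormula.realize_bdEqual, realize_zeroT, realize_succT, realize_addT,
    realize_mulT] at h
  obtain ⟨h1, h2, h3, h4, h5, h6, h7, h8⟩ := h
  refine ⟨h1, h2, h3, h4, h5, h6, h7, fun a b => ?_⟩
  have := h8 a b
  rw [BoundedFormula.realize_iff, realize_leF, BoundedFormula.realize_ex] at this
  simp only [BoundedFormula.realize_bdEqual, realize_addT] at this
  exact this

namespace ModelsQ

theorem stdElt_add (hM : ModelsQ M) (a b : ℕ) :
    stdElt M (a + b) = addM (stdElt M a) (stdElt M b) := by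
  induction b with
  | zero => exact (hM.add_zero _).symm
  | succ b ih => rw [← Nat.add_assoc, stdElt, ih, stdElt, hM.add_succ]

theorem stdElt_mul (hM : ModelsQ M) (a b : ℕ) :
    stdElt M (a * b) = mulM (stdElt M a) (stdElt M b) := by
  induction b with
  | zero => exact (hM.mul_zero _).symm
  | succ b ih => rw [Nat.mul_succ, hM.stdElt_add, ih, stdElt, hM.mul_succ]

theorem exists_of_le_stdElt (hM : ModelsQ M) (m : ℕ) : ∀ a : M,
    leM a (stdElt M m) → ∃ j ≤ m, a = stdElt M j := by
  induction m with
  | zero =>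
    intro a h
    by_cases ha : a = zeroM M
    · exact ⟨0, le_rfl, ha⟩
    obtain ⟨b, rfl⟩ := hM.eq_succ a ha
    obtain ⟨c, hc⟩ := (hM.le_iff _ _).1 h
    rw [hM.add_succ] at hc
    exact (hM.succ_ne_zero _ hc).elim
  | succ m ih =>
    intro a h
    by_cases ha : a = zeroM M
    · exact ⟨0, Nat.zero_le _, ha⟩
    obtain ⟨b, rfl⟩ := hM.eq_succ a ha
    obtain ⟨c, hc⟩ := (hM.le_iff _ _).1 h
    rw [hM.add_succ] at hc
    obtain ⟨j, hj, rfl⟩ := ih b ((hM.le_iff _ _).2 ⟨c, hM.succ_inj _ _ hc⟩)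
    exact ⟨j + 1, Nat.succ_le_succ hj, rfl⟩

theorem realize_stdElt (hM : ModelsQ M) {k : ℕ} (t : LA.Term (Empty ⊕ Fin k))
    (e : Empty → M) (e' : Empty → ℕ) (v : Fin k → ℕ) :
    t.realize (Sum.elim e fun i => stdElt M (v i)) = stdElt M (t.realize (Sum.elim e' v)) := by
  induction t with
  | var x =>
    rcases x with x | x
    · exact x.elim
    · rfl
  | func f ts ih =>
    simp only [Term.realize]
    rw [show (fun i => (ts i).realize (Sum.elim e fun i => stdElt M (v i))) = _ from funext ih]
    cases f with
    | zero =>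
      rw [Subsingleton.elim (fun i => stdElt M ((ts i).realize (Sum.elim e' v))) ![] ]
      rfl
    | succ =>
      simp only [Structure.funMap, stdElt]
      congr 1
      funext i
      rw [Subsingleton.elim i 0]
      rfl
    | add =>
      simp only [Structure.funMap, hM.stdElt_add]
      congr 1
      funext i
      refine Fin.cases rfl (fun j => ?_) i
      rw [Subsingleton.elim j 0]
      rfl
    | mul =>
      simp only [Structure.funMap, hM.stdElt_mul]
      congr 1
      funext i
      refine Fin.cases rfl (fun j => ?_) i
      rw [Subsingleton.elim j 0]
      rfl

/-- A model of `Q` that satisfies all true `Π_{n+1}`-sentences satisfies all true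
`Σ_{n+1}`-formulas at standard elements. -/
theorem realize_of_isSigma (hM : ModelsQ M) {n k : ℕ} {φ : LA.BoundedFormula Empty k}
    (h : IsSigma (n + 1) φ) (hPi : ∀ γ ∈ PiTh (n + 1), M ⊨ γ) (e : Empty → M) (e' : Empty → ℕ)
    (v : Fin k → ℕ)
    (hv : φ.Realize e' v) : φ.Realize e fun i => stdElt M (v i) := by
  match h with
  | .ofPi h =>
    have hsub := hPi (substFormula (fun i => numeralT (Empty ⊕ Fin 0) (v i)) φ)
    have := hsub ⟨(h.subst _).succ, by
      rw [Sentence.Realize, Formula.Realize, realize_substFormula]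
      simp only [realize_numeralT, stdElt_nat]
      convert hv⟩
    rw [Sentence.Realize, Formula.Realize, realize_substFormula] at this
    simp only [realize_numeralT] at this
    convert this
  | .ex h =>
    rw [BoundedFormula.realize_ex] at hv ⊢
    obtain ⟨a, ha⟩ := hv
    refine ⟨stdElt M a, ?_⟩
    have := realize_of_isSigma hM h hPi e e' _ ha
    convert this using 1
    funext i
    refine Fin.lastCases ?_ (fun j => ?_) i <;> simp
  | .inf h₁ h₂ =>
    rw [BoundedFormula.realize_inf] at hv ⊢
    exact ⟨realize_of_isSigma hM h₁ hPi e e' v hv.1, realize_of_isSigma hM h₂ hPi e e' v hv.2⟩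
  | .sup h₁ h₂ =>
    rw [BoundedFormula.realize_sup] at hv ⊢
    exact hv.imp (realize_of_isSigma hM h₁ hPi e e' v) (realize_of_isSigma hM h₂ hPi e e' v)
  | .bdall t h =>
    rw [realize_bdall] at hv ⊢
    intro a ha
    rw [hM.realize_stdElt t e e' v] at ha
    obtain ⟨j, hj, rfl⟩ := hM.exists_of_le_stdElt _ a ha
    have := realize_of_isSigma hM h hPi e e' _ (hv j hj)
    convert this using 1
    funext i
    refine Fin.lastCases ?_ (fun j => ?_) i <;> simp

end ModelsQ

end QModels

/-! ### Arithmetically definable relations -/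

/-- `f` is the function defined by a term. -/
def TermFun {k : ℕ} (f : (Fin k → ℕ) → ℕ) : Prop :=
  ∃ t : LA.Term (Empty ⊕ Fin k), ∀ v, t.realize (Sum.elim (fun e => Empty.elim e) v) = f v

/-- `P` is defined in `ℕ` by a `Σ_{n+1}`-formula. -/
def SigmaRel (n : ℕ) {k : ℕ} (P : (Fin k → ℕ) → Prop) : Prop :=
  ∃ φ : LA.BoundedFormula Empty k, IsSigma (n + 1) φ ∧
    ∀ v, φ.Realize (fun e => Empty.elim e) v ↔ P v

namespace TermFun

variable {k : ℕ} {f g : (Fin k → ℕ) → ℕ}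

theorem var (i : Fin k) : TermFun fun v => v i := ⟨&i, fun _ => rfl⟩

theorem const (m : ℕ) : TermFun fun _ : Fin k → ℕ => m :=
  ⟨numeralT _ m, fun v => by rw [realize_numeralT, stdElt_nat]⟩

theorem add (hf : TermFun f) (hg : TermFun g) : TermFun fun v => f v + g v := by
  obtain ⟨t, ht⟩ := hf
  obtain ⟨s, hs⟩ := hg
  exact ⟨addT t s, fun v => by rw [realize_addT, ht, hs]; rfl⟩

theorem mul (hf : TermFun f) (hg : TermFun g) : TermFun fun v => f v * g v := by
  obtain ⟨t, ht⟩ := hf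
  obtain ⟨s, hs⟩ := hg
  exact ⟨mulT t s, fun v => by rw [realize_mulT, ht, hs]; rfl⟩

theorem succ (hf : TermFun f) : TermFun fun v => f v + 1 := hf.add (const 1)

theorem castSucc (hf : TermFun f) :
    TermFun fun w : Fin (k + 1) → ℕ => f fun i => w i.castSucc := by
  obtain ⟨t, ht⟩ := hf
  refine ⟨liftT t, fun v => ?_⟩
  change (liftT t).realize _ = f fun i => v i.castSucc
  rw [← ht, ← realize_liftT t _ _ (v (Fin.last k))]
  congr 2
  exact (Fin.snoc_init_self v).symm

end TermFun

namespace SigmaRel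

variable {n k : ℕ} {P R : (Fin k → ℕ) → Prop} {f g : (Fin k → ℕ) → ℕ}

theorem congr (h : SigmaRel n P) (H : ∀ v, P v ↔ R v) : SigmaRel n R := by
  obtain ⟨φ, hφ, hP⟩ := h
  exact ⟨φ, hφ, fun v => (hP v).trans (H v)⟩

theorem of_delta0 {φ : LA.BoundedFormula Empty k} (h : Delta0 φ)
    (H : ∀ v, φ.Realize (fun e => Empty.elim e) v ↔ P v) : SigmaRel n P :=
  ⟨φ, .ofPi h.isPi, H⟩

theorem eq (hf : TermFun f) (hg : TermFun g) : SigmaRel n fun v => f v = g v := by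
  obtain ⟨t, ht⟩ := hf
  obtain ⟨s, hs⟩ := hg
  exact of_delta0 (.equal t s) fun v => by rw [BoundedFormula.realize_bdEqual, ht, hs]

theorem le (hf : TermFun f) (hg : TermFun g) : SigmaRel n fun v => f v ≤ g v := by
  obtain ⟨t, ht⟩ := hf
  obtain ⟨s, hs⟩ := hg
  exact of_delta0 (.le t s) fun v => by rw [realize_leF, ht, hs]; rfl

theorem lt (hf : TermFun f) (hg : TermFun g) : SigmaRel n fun v => f v < g v :=
  (le hf.succ hg).congr fun _ => Iff.rfl

theorem and (hP : SigmaRel n P) (hR : SigmaRel n R) : SigmaRel n fun v => P v ∧ R v := by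
  obtain ⟨φ, hφ, hP⟩ := hP
  obtain ⟨ψ, hψ, hR⟩ := hR
  exact ⟨φ ⊓ ψ, .inf hφ hψ, fun v => by rw [BoundedFormula.realize_inf, hP, hR]⟩

theorem or (hP : SigmaRel n P) (hR : SigmaRel n R) : SigmaRel n fun v => P v ∨ R v := by
  obtain ⟨φ, hφ, hP⟩ := hP
  obtain ⟨ψ, hψ, hR⟩ := hR
  exact ⟨φ ⊔ ψ, .sup hφ hψ, fun v => by rw [BoundedFormula.realize_sup, hP, hR]⟩

theorem ex {P : (Fin k → ℕ) → ℕ → Prop}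
    (h : SigmaRel n fun w : Fin (k + 1) → ℕ => P (fun i => w i.castSucc) (w (Fin.last k))) :
    SigmaRel n fun v => ∃ x, P v x := by
  obtain ⟨φ, hφ, H⟩ := h
  exact ⟨φ.ex, .ex hφ, fun v => by simp [BoundedFormula.realize_ex, H]⟩

theorem ball_lt {P : (Fin k → ℕ) → ℕ → Prop} (hf : TermFun f)
    (h : SigmaRel n fun w : Fin (k + 1) → ℕ => P (fun i => w i.castSucc) (w (Fin.last k))) :
    SigmaRel n fun v => ∀ x < f v, P v x := by
  obtain ⟨φ, hφ, H⟩ := (le hf.castSucc (TermFun.var (Fin.last k))).or h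
  obtain ⟨t, ht⟩ := hf
  refine ⟨_, .bdall t hφ, fun v => ?_⟩
  rw [realize_bdall]
  simp only [H, ht, Fin.snoc_last, Fin.snoc_castSucc]
  refine ⟨fun h x hx => (h x hx.le).resolve_left hx.not_ge, fun h x _ => ?_⟩
  by_cases hx : x < f v
  · exact Or.inr (h x hx)
  · exact Or.inl (not_lt.1 hx)

theorem comp (h : SigmaRel n P) {l : ℕ} {σ : Fin k → (Fin l → ℕ) → ℕ}
    (hσ : ∀ i, TermFun (σ i)) : SigmaRel n fun v => P fun i => σ i v := by
  obtain ⟨φ, hφ, H⟩ := h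
  choose t ht using hσ
  exact ⟨substFormula t φ, hφ.subst t, fun v => by
    rw [realize_substFormula, H]; simp only [ht]⟩

end SigmaRel

/-- A set of natural numbers is defined by a `Σ_{n+1}`-formula. -/
def SigmaSet (n : ℕ) (P : ℕ → Prop) : Prop := SigmaRel n fun v : Fin 1 → ℕ => P (v 0)

/-- A binary relation on `ℕ` is defined by a `Σ_{n+1}`-formula. -/
def SigmaRel₂ (n : ℕ) (P : ℕ → ℕ → Prop) : Prop :=
  SigmaRel n fun v : Fin 2 → ℕ => P (v 0) (v 1)

theorem SigmaSet.app {n k : ℕ} {P : ℕ → Prop} (h : SigmaSet n P) {f : (Fin k → ℕ) → ℕ}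
    (hf : TermFun f) : SigmaRel n fun v => P (f v) :=
  SigmaRel.comp h (σ := fun _ => f) fun _ => hf

theorem SigmaRel₂.app {n k : ℕ} {P : ℕ → ℕ → Prop} (h : SigmaRel₂ n P)
    {f g : (Fin k → ℕ) → ℕ} (hf : TermFun f) (hg : TermFun g) :
    SigmaRel n fun v => P (f v) (g v) := by
  refine SigmaRel.congr (SigmaRel.comp h (σ := ![f, g]) fun i => ?_) fun v => Iff.rfl
  fin_cases i
  · exact hf
  · exact hg

namespace SigmaRel

variable {n k : ℕ} {f g s : (Fin k → ℕ) → ℕ}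

theorem pair_eq (hf : TermFun f) (hg : TermFun g) (hs : TermFun s) :
    SigmaRel n fun v => Nat.pair (f v) (g v) = s v := by
  refine (((lt hf hg).and (eq ((hg.mul hg).add hf) hs)).or
    ((le hg hf).and (eq (((hf.mul hf).add hf).add hg) hs))).congr fun v => ?_
  unfold Nat.pair
  by_cases h : f v < g v
  · simp [h]
  · simp [h, not_lt.1 h]

theorem mod_eq (hf : TermFun f) (hg : TermFun g) (hs : TermFun s) (hpos : ∀ v, 0 < g v) :
    SigmaRel n fun v => f v % g v = s v := by
  refine (((lt hs hg).and (ex (P := fun v q => f v = g v * q + s v)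
    (eq hf.castSucc ((hg.castSucc.mul (.var _)).add hs.castSucc))))).congr fun v => ?_
  constructor
  · rintro ⟨h, q, hq⟩
    rw [hq, Nat.mul_add_mod, Nat.mod_eq_of_lt h]
  · intro h
    exact h ▸ ⟨Nat.mod_lt _ (hpos v), _, (Nat.div_add_mod _ _).symm⟩

theorem beta_eq (hf : TermFun f) (hg : TermFun g) (hs : TermFun s) :
    SigmaRel n fun v => Nat.beta (f v) (g v) = s v := by
  refine (ex (P := fun v a => ∃ b, Nat.pair a b = f v ∧ a % ((g v + 1) * b + 1) = s v)
    (ex (P := fun w b => Nat.pair (w (Fin.last k)) b = f (fun i => w i.castSucc) ∧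
        w (Fin.last k) % ((g (fun i => w i.castSucc) + 1) * b + 1) = s (fun i => w i.castSucc))
      ((pair_eq (.var _) (.var _) hf.castSucc.castSucc).and
      (mod_eq (.var _) ((hg.castSucc.castSucc.succ.mul (.var _)).succ) hs.castSucc.castSucc
        fun _ => Nat.succ_pos _)))).congr fun v => ?_
  constructor
  · rintro ⟨a, b, hab, h⟩
    rw [Nat.beta, ← hab, Nat.unpair_pair]
    exact h
  · intro h
    exact ⟨(f v).unpair.1, (f v).unpair.2, Nat.pair_unpair _, h⟩

end SigmaRel

/-! ### Graphs of partial recursive functions -/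

theorem exists_beta_seq (f : ℕ → ℕ) (n : ℕ) : ∃ s, ∀ i ≤ n, Nat.beta s i = f i := by
  refine ⟨Nat.unbeta ((List.range (n + 1)).map f), fun i hi => ?_⟩
  have := Nat.beta_unbeta_coe ((List.range (n + 1)).map f) ⟨i, by simp; omega⟩
  simpa using this

theorem mem_natRec_iff (f : ℕ →. ℕ) (g : ℕ →. ℕ) (a n y : ℕ) :
    y ∈ (Nat.rec (f a) (fun y IH => IH >>= fun i => g (Nat.pair a (Nat.pair y i))) n : Part ℕ) ↔
      ∃ s, Nat.beta s 0 ∈ f a ∧ Nat.beta s n = y ∧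
        ∀ i < n, Nat.beta s (i + 1) ∈ g (Nat.pair a (Nat.pair i (Nat.beta s i))) := by
  constructor
  · intro h
    have key : ∃ c : ℕ → ℕ, c 0 ∈ f a ∧ c n = y ∧
        ∀ i < n, c (i + 1) ∈ g (Nat.pair a (Nat.pair i (c i))) := by
      induction n generalizing y with
      | zero => exact ⟨fun _ => y, h, rfl, by simp⟩
      | succ n ih =>
        obtain ⟨z, hz, hy⟩ := Part.mem_bind_iff.1 h
        obtain ⟨c, h0, hn, hc⟩ := ih z hz
        refine ⟨fun i => if i ≤ n then c i else y, by simpa using h0, by simp, fun i hi => ?_⟩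
        rcases Nat.lt_succ_iff_lt_or_eq.1 hi with hi | rfl
        · simpa [hi.le, Nat.succ_le_of_lt hi] using hc i hi
        · simpa [hn] using hy
    obtain ⟨c, h0, hn, hc⟩ := key
    obtain ⟨s, hs⟩ := exists_beta_seq c n
    refine ⟨s, by rwa [hs 0 (Nat.zero_le _)], by rw [hs n le_rfl, hn], fun i hi => ?_⟩
    rw [hs i hi.le, hs (i + 1) hi]
    exact hc i hi
  · rintro ⟨s, h0, rfl, hs⟩
    induction n with
    | zero => exact h0
    | succ n ih =>
      exact Part.mem_bind_iff.2 ⟨_, ih fun i hi => hs i (Nat.lt_succ_of_lt hi),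
        hs n (Nat.lt_succ_self n)⟩

theorem sigmaRel₂_of_partrec {n : ℕ} {f : ℕ →. ℕ} (hf : Nat.Partrec f) :
    SigmaRel₂ n fun x y => y ∈ f x := by
  induction hf with
  | zero =>
    refine (SigmaRel.eq (.var 1) (.const 0)).congr fun v => ?_
    exact Part.mem_some_iff.symm
  | succ =>
    refine (SigmaRel.eq (.var 1) (TermFun.var 0).succ).congr fun v => ?_
    exact Part.mem_some_iff.symm
  | left =>
    refine (SigmaRel.ex (P := fun v b => Nat.pair (v 1) b = v 0)
      (.pair_eq (.var _) (.var _) (.var _))).congr fun v => ?_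
    change _ ↔ v 1 ∈ Part.some (Nat.unpair (v 0)).1
    rw [Part.mem_some_iff]
    exact ⟨fun ⟨b, h⟩ => by rw [← h, Nat.unpair_pair],
      fun h => ⟨_, by rw [h]; exact Nat.pair_unpair _⟩⟩
  | right =>
    refine (SigmaRel.ex (P := fun v b => Nat.pair b (v 1) = v 0)
      (.pair_eq (.var _) (.var _) (.var _))).congr fun v => ?_
    change _ ↔ v 1 ∈ Part.some (Nat.unpair (v 0)).2
    rw [Part.mem_some_iff]
    exact ⟨fun ⟨b, h⟩ => by rw [← h, Nat.unpair_pair],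
      fun h => ⟨_, by rw [h]; exact Nat.pair_unpair _⟩⟩
  | @pair f g _ _ ihf ihg =>
    refine (SigmaRel.ex (P := fun v a => ∃ b, a ∈ f (v 0) ∧ b ∈ g (v 0) ∧ Nat.pair a b = v 1)
      (SigmaRel.ex (P := fun w b => w 2 ∈ f (w 0) ∧ b ∈ g (w 0) ∧ Nat.pair (w 2) b = w 1)
        ((SigmaRel₂.app ihf (.var _) (.var _)).and ((SigmaRel₂.app ihg (.var _) (.var _)).and
          (.pair_eq (.var _) (.var _) (.var _)))))).congr fun v => ?_
    simp only [Seq.seq, Part.map_eq_map, Part.bind_map, Part.mem_bind_iff, Part.mem_map_iff]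
    grind
  | @comp f g _ _ ihf ihg =>
    refine (SigmaRel.ex (P := fun v a => a ∈ g (v 0) ∧ v 1 ∈ f a)
      ((SigmaRel₂.app ihg (.var _) (.var _)).and
        (SigmaRel₂.app ihf (.var _) (.var _)))).congr fun v => ?_
    exact Part.mem_bind_iff.symm
  | @prec f g _ _ ihf ihg =>
    have step : SigmaRel n fun w : Fin 5 → ℕ => ∃ c d e q, Nat.beta (w 3) (w 4) = c ∧
        Nat.beta (w 3) (w 4 + 1) = d ∧ Nat.pair (w 4) c = e ∧ Nat.pair (w 2) e = q ∧ d ∈ g q := by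
      refine SigmaRel.ex (SigmaRel.ex (SigmaRel.ex (SigmaRel.ex ?_)))
      exact (SigmaRel.beta_eq (.var _) (.var _) (.var _)).and
        ((SigmaRel.beta_eq (.var _) (TermFun.var _).succ (.var _)).and
        ((SigmaRel.pair_eq (.var _) (.var _) (.var _)).and
        ((SigmaRel.pair_eq (.var _) (.var _) (.var _)).and
        (SigmaRel₂.app ihg (.var _) (.var _)))))
    have body : SigmaRel n fun v : Fin 2 → ℕ => ∃ a s m z, Nat.pair a m = v 0 ∧
        Nat.beta s 0 = z ∧ z ∈ f a ∧ Nat.beta s m = v 1 ∧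
        ∀ i < m, ∃ c d e q, Nat.beta s i = c ∧ Nat.beta s (i + 1) = d ∧
          Nat.pair i c = e ∧ Nat.pair a e = q ∧ d ∈ g q := by
      refine SigmaRel.ex (SigmaRel.ex (SigmaRel.ex (SigmaRel.ex ?_)))
      refine (SigmaRel.pair_eq (.var _) (.var _) (.var _)).and
        ((SigmaRel.beta_eq (.var _) (.const 0) (.var _)).and
        ((SigmaRel₂.app ihf (.var _) (.var _)).and
        ((SigmaRel.beta_eq (.var _) (.var _) (.var _)).and (SigmaRel.ball_lt (.var _) ?_))))
      exact (SigmaRel.comp step (σ := ![fun v => v 0, fun v => v 1, fun v => v 2, fun v => v 3,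
        fun v => v 6]) (fun i => by fin_cases i <;> exact .var _)).congr fun v => Iff.rfl
    refine body.congr fun v => ?_
    change _ ↔ v 1 ∈ (Nat.rec (f (v 0).unpair.1)
      (fun y IH => IH >>= fun i => g (Nat.pair (v 0).unpair.1 (Nat.pair y i)))
      (v 0).unpair.2 : Part ℕ)
    rw [mem_natRec_iff]
    constructor
    · rintro ⟨a, s, m, z, hp, rfl, hz, hm, h⟩
      rw [← hp, Nat.unpair_pair]
      refine ⟨s, hz, hm, fun i hi => ?_⟩
      obtain ⟨_, _, _, _, rfl, rfl, rfl, rfl, h⟩ := h i hi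
      exact h
    · rintro ⟨s, hz, hm, h⟩
      exact ⟨_, s, _, _, Nat.pair_unpair _, rfl, hz, hm,
        fun i hi => ⟨_, _, _, _, rfl, rfl, rfl, rfl, h i hi⟩⟩
  | @rfind f _ ihf =>
    have body : SigmaRel n fun v : Fin 2 → ℕ => ∃ q z, Nat.pair (v 0) (v 1) = q ∧ 0 = z ∧
        z ∈ f q ∧ ∀ i < v 1, ∃ q z, Nat.pair (v 0) i = q ∧ z + 1 ∈ f q := by
      refine SigmaRel.ex (SigmaRel.ex ?_)
      refine (SigmaRel.pair_eq (.var _) (.var _) (.var _)).and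
        ((SigmaRel.eq (.const 0) (.var _)).and
        ((SigmaRel₂.app ihf (.var _) (.var _)).and (SigmaRel.ball_lt (.var _) ?_)))
      refine SigmaRel.ex (SigmaRel.ex ?_)
      exact (SigmaRel.pair_eq (.var _) (.var _) (.var _)).and
        (SigmaRel₂.app ihf (.var _) (TermFun.var _).succ)
    refine body.congr fun v => ?_
    refine Iff.trans ?_ Nat.mem_rfind.symm
    simp only [Part.map_eq_map, Part.mem_map_iff]
    constructor
    · rintro ⟨_, _, rfl, rfl, h, H⟩
      refine ⟨⟨0, h, by simp⟩, fun {i} hi => ?_⟩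
      obtain ⟨_, z, rfl, hz⟩ := H i hi
      exact ⟨_, hz, by simp⟩
    · rintro ⟨⟨z, hz, h0⟩, H⟩
      refine ⟨_, _, rfl, rfl, ?_, fun i hi => ?_⟩
      · rwa [of_decide_eq_true h0] at hz
      · obtain ⟨z, hz, hz0⟩ := H hi
        refine ⟨_, z - 1, rfl, ?_⟩
        rwa [Nat.sub_add_cancel (Nat.pos_of_ne_zero (of_decide_eq_false hz0))]

/-! ### Definable predicates on encoded types -/

attribute [local fun_prop] Primrec Primrec.id Primrec.const Primrec.comp Primrec.fst Primrec.snd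
  Primrec.pair

open Encodable in
/-- A predicate on an encoded type is defined by a `Σ_{n+1}`-formula on codes. -/
def SD (n : ℕ) {α : Type} [Primcodable α] (P : α → Prop) : Prop :=
  SigmaSet n fun x => ∃ a : α, decode x = some a ∧ P a

namespace SD

open Encodable

variable {n : ℕ} {α β : Type} [Primcodable α] [Primcodable β] {P R : α → Prop}

theorem sigmaSet (h : SD n P) : SigmaSet n fun x => ∃ a : α, decode x = some a ∧ P a := h

theorem of_sigmaSet {P : ℕ → Prop} (h : SigmaSet n P) : SD n P :=
  SigmaRel.congr h fun v => by simp

theorem sigmaSet_nat {P : ℕ → Prop} (h : SD n P) : SigmaSet n P :=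
  SigmaRel.congr h fun v => by simp

theorem congr (h : SD n P) (H : ∀ a, P a ↔ R a) : SD n R := by
  have : P = R := funext fun a => propext (H a)
  exact this ▸ h

theorem and (hP : SD n P) (hR : SD n R) : SD n fun a => P a ∧ R a :=
  (SigmaRel.and hP hR).congr fun v => by
    constructor
    · rintro ⟨⟨a, ha, hP⟩, b, hb, hR⟩
      obtain rfl : a = b := Option.some.inj (ha.symm.trans hb)
      exact ⟨a, ha, hP, hR⟩
    · rintro ⟨a, ha, hP, hR⟩
      exact ⟨⟨a, ha, hP⟩, a, ha, hR⟩

theorem or (hP : SD n P) (hR : SD n R) : SD n fun a => P a ∨ R a :=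
  (SigmaRel.or hP hR).congr fun v => by
    constructor
    · rintro (⟨a, ha, h⟩ | ⟨a, ha, h⟩)
      · exact ⟨a, ha, Or.inl h⟩
      · exact ⟨a, ha, Or.inr h⟩
    · rintro ⟨a, ha, h | h⟩
      · exact Or.inl ⟨a, ha, h⟩
      · exact Or.inr ⟨a, ha, h⟩

theorem graph {f : α → β} (hf : Primrec f) :
    SigmaRel₂ n fun x y => ∃ a : α, decode x = some a ∧ y = encode (f a) := by
  have h := sigmaRel₂_of_partrec (n := n) (f := fun n => _) hf.to_comp
  refine SigmaRel.congr h fun v => ?_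
  refine Part.mem_bind_iff.trans ?_
  refine exists_congr fun a => and_congr Part.mem_ofOption ?_
  refine (Part.mem_map_iff _).trans ⟨?_, fun h => ⟨f a, Part.mem_some _, h.symm⟩⟩
  rintro ⟨b, hb, h⟩
  rw [← h, Part.mem_some_iff.1 hb]

theorem comp {P : β → Prop} (hP : SD n P) {f : α → β} (hf : Primrec f) :
    SD n fun a => P (f a) := by
  refine (SigmaRel.ex (P := fun v y => (∃ a : α, decode (v 0) = some a ∧ y = encode (f a)) ∧
    ∃ b : β, decode y = some b ∧ P b)
    (((graph hf).app (.var _) (.var _)).and (hP.sigmaSet.app (.var _)))).congr fun v => ?_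
  constructor
  · rintro ⟨_, ⟨a, ha, rfl⟩, b, hb, h⟩
    rw [encodek, Option.some_inj] at hb
    subst hb
    exact ⟨a, ha, h⟩
  · rintro ⟨a, ha, h⟩
    exact ⟨_, ⟨a, ha, rfl⟩, _, encodek _, h⟩

theorem of_primrecPred (h : PrimrecPred P) : SD n P := by
  obtain ⟨_, h⟩ := h
  refine (SigmaRel.ex (P := fun v y =>
    (∃ a : α, decode (v 0) = some a ∧ y = encode (decide (P a))) ∧ y = 1)
    (((graph h).app (.var _) (.var _)).and (.eq (.var _) (.const 1)))).congr fun v => ?_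
  constructor
  · rintro ⟨_, ⟨a, ha, rfl⟩, h⟩
    refine ⟨a, ha, ?_⟩
    by_contra hP
    simp [hP] at h
  · rintro ⟨a, ha, h⟩
    exact ⟨_, ⟨a, ha, rfl⟩, by simp [h]⟩

theorem eq {f g : α → β} (hf : Primrec f) (hg : Primrec g) : SD n fun a => f a = g a :=
  of_primrecPred (Primrec.eq.comp hf hg)

theorem lt {f g : α → ℕ} (hf : Primrec f) (hg : Primrec g) : SD n fun a => f a < g a :=
  of_primrecPred (Primrec.nat_lt.comp hf hg)

theorem ex {P : α → β → Prop} (h : SD n fun p : α × β => P p.1 p.2) :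
    SD n fun a => ∃ b, P a b := by
  refine (SigmaRel.ex (P := fun v y => ∃ q, Nat.pair (v 0) y = q ∧
      ∃ p : α × β, decode q = some p ∧ P p.1 p.2) (.ex ((SigmaRel.pair_eq (.var _) (.var _)
      (.var _)).and (h.sigmaSet.app (.var _))))).congr fun v => ?_
  constructor
  · rintro ⟨y, _, rfl, ⟨a, b⟩, hp, h⟩
    simp only [decode_prod_val, Nat.unpair_pair, Option.bind_eq_some_iff, Option.map_eq_some_iff,
      Prod.mk.injEq] at hp
    obtain ⟨_, ha, _, hb, rfl, rfl⟩ := hp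
    exact ⟨_, ha, _, h⟩
  · rintro ⟨a, ha, b, h⟩
    refine ⟨encode b, _, rfl, (a, b), ?_, h⟩
    simp [ha]

theorem ball_lt {P : α → ℕ → Prop} {t : α → ℕ} (ht : Primrec t)
    (h : SD n fun p : α × ℕ => P p.1 p.2) : SD n fun a => ∀ i < t a, P a i := by
  refine (SigmaRel.ex (P := fun v m => (∃ a : α, decode (v 0) = some a ∧ m = encode (t a)) ∧
      ∀ i < m, ∃ q, Nat.pair (v 0) i = q ∧ ∃ p : α × ℕ, decode q = some p ∧ P p.1 p.2)
      (((graph ht).app (.var _) (.var _)).and (.ball_lt (.var _)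
        (.ex ((SigmaRel.pair_eq (.var _) (.var _) (.var _)).and
          (h.sigmaSet.app (.var _))))))).congr fun v => ?_
  constructor
  · rintro ⟨_, ⟨a, ha, rfl⟩, h⟩
    refine ⟨a, ha, fun i hi => ?_⟩
    obtain ⟨_, rfl, ⟨b, j⟩, hp, h⟩ := h i hi
    simp only [decode_prod_val, Nat.unpair_pair, Option.bind_eq_some_iff, Option.map_eq_some_iff,
      Prod.mk.injEq, ha, decode_nat] at hp
    obtain ⟨_, ha, _, hb, rfl, rfl⟩ := hp
    cases ha
    cases hb
    exact h
  · rintro ⟨a, ha, h⟩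
    refine ⟨_, ⟨a, ha, rfl⟩, fun i hi => ⟨_, rfl, (a, i), ?_, h i hi⟩⟩
    simp [ha]

theorem range {P : β → Prop} (hP : SD n P) {f : β → α} (hf : Primrec f) :
    SD n fun a => ∃ b, P b ∧ a = f b :=
  ex ((hP.comp .snd).and (eq .fst (hf.comp .snd)))

theorem range' {f : β → α} (hf : Primrec f) : SD n fun a => ∃ b, a = f b :=
  ex (eq .fst (hf.comp .snd))

end SD

/-- The closure of the predicate `I` under a binary rule `S`: from `y` and `z` infer every `x`
with `S y z x`. -/
inductive Gen {α : Type} (I : α → Prop) (S : α → α → α → Prop) : α → Prop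
  | base {x : α} : I x → Gen I S x
  | step {y z x : α} : Gen I S y → Gen I S z → S y z x → Gen I S x

section Gen

variable {α : Type} {I : α → Prop} {S : α → α → α → Prop}

/-- Each entry of a derivation is initial or follows from entries further down the list. -/
def IsDerivation (I : α → Prop) (S : α → α → α → Prop) (l : List α) : Prop :=
  ∀ i < l.length, ∃ x, l[i]? = some x ∧ (I x ∨ ∃ q : (ℕ × ℕ) × α × α, i < q.1.1 ∧ i < q.1.2 ∧
    l[q.1.1]? = some q.2.1 ∧ l[q.1.2]? = some q.2.2 ∧ S q.2.1 q.2.2 x)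

theorem IsDerivation.cons {l : List α} (hl : IsDerivation I S l) {x : α}
    (hx : I x ∨ ∃ y ∈ l, ∃ z ∈ l, S y z x) : IsDerivation I S (x :: l) := by
  rintro (_ | i) hi
  · refine ⟨x, rfl, hx.imp id ?_⟩
    rintro ⟨y, hy, z, hz, h⟩
    obtain ⟨j, hj⟩ := List.mem_iff_getElem?.1 hy
    obtain ⟨k, hk⟩ := List.mem_iff_getElem?.1 hz
    exact ⟨((j + 1, k + 1), y, z), Nat.succ_pos _, Nat.succ_pos _, by simpa, by simpa, h⟩
  · obtain ⟨y, hy, h⟩ := hl i (by simpa using hi)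
    refine ⟨y, by simpa, h.imp id ?_⟩
    rintro ⟨⟨⟨j, k⟩, z, w⟩, hj, hk, h1, h2, h⟩
    exact ⟨((j + 1, k + 1), z, w), Nat.succ_lt_succ hj, Nat.succ_lt_succ hk, by simpa, by simpa, h⟩

theorem getElem?_append_of_eq_some {l l' : List α} {i : ℕ} {x : α} (h : l[i]? = some x) :
    (l ++ l')[i]? = some x := by
  rw [List.getElem?_append_left (List.getElem?_eq_some_iff.1 h).1, h]

theorem getElem?_append_length_add (l l' : List α) (i : ℕ) :
    (l ++ l')[l.length + i]? = l'[i]? := by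
  rw [List.getElem?_append_right (Nat.le_add_right _ _), Nat.add_sub_cancel_left]

theorem IsDerivation.append {l l' : List α} (hl : IsDerivation I S l)
    (hl' : IsDerivation I S l') : IsDerivation I S (l ++ l') := by
  intro i hi
  by_cases h : i < l.length
  · obtain ⟨y, hy, h⟩ := hl i h
    refine ⟨y, getElem?_append_of_eq_some hy, h.imp id ?_⟩
    rintro ⟨q, hj, hk, h1, h2, h⟩
    exact ⟨q, hj, hk, getElem?_append_of_eq_some h1, getElem?_append_of_eq_some h2, h⟩
  · obtain ⟨i, rfl⟩ := Nat.exists_eq_add_of_le (not_lt.1 h)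
    obtain ⟨y, hy, h⟩ := hl' i (by simpa using hi)
    refine ⟨y, by rwa [getElem?_append_length_add], h.imp id ?_⟩
    rintro ⟨⟨⟨j, k⟩, z, w⟩, hj, hk, h1, h2, h⟩
    exact ⟨((l.length + j, l.length + k), z, w), Nat.add_lt_add_left hj _,
      Nat.add_lt_add_left hk _, by rwa [getElem?_append_length_add],
      by rwa [getElem?_append_length_add], h⟩

theorem IsDerivation.gen {l : List α} (hl : IsDerivation I S l) {x : α} (hx : x ∈ l) :
    Gen I S x := by
  obtain ⟨i, hi⟩ := List.mem_iff_getElem?.1 hx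
  induction h : l.length - i using Nat.strong_induction_on generalizing i x with
  | _ d ih =>
    subst h
    have hlt : i < l.length := (List.getElem?_eq_some_iff.1 hi).1
    obtain ⟨y, hy, h⟩ := hl i hlt
    obtain rfl : x = y := Option.some.inj (hi.symm.trans hy)
    rcases h with h | ⟨⟨⟨j, k⟩, z, w⟩, hj, hk, h1, h2, h⟩
    · exact .base h
    · exact .step (ih _ (by dsimp only at *; omega) (List.mem_of_getElem? h1) j h1 rfl)
        (ih _ (by dsimp only at *; omega) (List.mem_of_getElem? h2) k h2 rfl) h

theorem gen_iff_exists_derivation {x : α} :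
    Gen I S x ↔ ∃ l : List α, l[0]? = some x ∧ IsDerivation I S l := by
  constructor
  · intro h
    induction h with
    | @base x h => exact ⟨[x], rfl, IsDerivation.cons (fun i hi => by simp at hi) (Or.inl h)⟩
    | @step y z x _ _ h ihy ihz =>
      obtain ⟨l, hy, hl⟩ := ihy
      obtain ⟨m, hz, hm⟩ := ihz
      exact ⟨x :: (l ++ m), rfl, (hl.append hm).cons (Or.inr
        ⟨y, List.mem_append_left _ (List.mem_of_getElem? hy), z,
          List.mem_append_right _ (List.mem_of_getElem? hz), h⟩)⟩
  · rintro ⟨l, hx, hl⟩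
    exact hl.gen (List.mem_of_getElem? hx)

theorem primrec_getElem? {α β : Type} [Primcodable α] [Primcodable β] {f : β → List α}
    {g : β → ℕ} (hf : Primrec f) (hg : Primrec g) : Primrec fun b => (f b)[g b]? :=
  Primrec.list_getElem?.comp hf hg

attribute [local fun_prop] primrec_getElem? Primrec.option_some Primrec.list_length

theorem SD.isDerivation {n : ℕ} [Primcodable α] (hI : SD n I)
    (hS : SD n fun p : α × α × α => S p.1 p.2.1 p.2.2) : SD n (IsDerivation I S) := by
  refine ball_lt Primrec.list_length (ex ((SD.eq (by fun_prop) (by fun_prop)).and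
    ((hI.comp .snd).or (ex ?_))))
  refine (SD.lt (by fun_prop) (by fun_prop)).and ((SD.lt (by fun_prop) (by fun_prop)).and
    ((SD.eq (by fun_prop) (by fun_prop)).and ((SD.eq (by fun_prop) (by fun_prop)).and ?_)))
  exact hS.comp (f := fun p : ((List α × ℕ) × α) × (ℕ × ℕ) × α × α => (p.2.2.1, p.2.2.2, p.1.2))
    (by fun_prop)

theorem SD.gen {n : ℕ} [Primcodable α] (hI : SD n I)
    (hS : SD n fun p : α × α × α => S p.1 p.2.1 p.2.2) : SD n (Gen I S) :=
  SD.congr (ex ((SD.eq (by fun_prop) (by fun_prop)).and ((hI.isDerivation hS).comp .snd)))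
    fun _ => gen_iff_exists_derivation.symm

end Gen

/-! ### Syntax trees -/

/-- Labelled binary trees, used as codes of both terms and formulas. The leaf `2 * j` is the
variable `j` and the leaf `2 * j + 1` is the constant `j`. -/
inductive Tr
  | leaf (n : ℕ)
  | node (n : ℕ) (a b : Tr)

namespace Tr

/-- The numerical code of a tree. -/
def enc : Tr → ℕ
  | leaf n => 2 * n
  | node n a b => 2 * Nat.pair n (Nat.pair a.enc b.enc) + 1

/-- The tree with a given code. -/
def dec (m : ℕ) : Tr :=
  if h : m % 2 = 0 then leaf (m / 2) else
    node (m / 2).unpair.1 (dec (m / 2).unpair.2.unpair.1) (dec (m / 2).unpair.2.unpair.2)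
termination_by m
decreasing_by
  · have h1 := Nat.unpair_left_le (m / 2).unpair.2
    have h2 := Nat.unpair_right_le (m / 2)
    omega
  · have h1 := Nat.unpair_right_le (m / 2).unpair.2
    have h2 := Nat.unpair_right_le (m / 2)
    omega

theorem dec_enc (t : Tr) : dec t.enc = t := by
  induction t with
  | leaf n => rw [enc, dec]; simp
  | node n a b iha ihb =>
    have h : (2 * Nat.pair n (Nat.pair a.enc b.enc) + 1) / 2 = Nat.pair n (Nat.pair a.enc b.enc) :=
      by omega
    rw [enc, dec, h]
    simp [Nat.add_mod, iha, ihb]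

theorem enc_dec (m : ℕ) : (dec m).enc = m := by
  induction m using Nat.strong_induction_on with
  | _ m ih =>
    rw [dec]
    split_ifs with h
    · rw [enc]; omega
    · have h1 := Nat.unpair_left_le (m / 2).unpair.2
      have h2 := Nat.unpair_right_le (m / 2).unpair.2
      have h3 := Nat.unpair_right_le (m / 2)
      rw [enc, ih _ (by omega), ih _ (by omega), Nat.pair_unpair, Nat.pair_unpair]
      omega

/-- Trees correspond to natural numbers. -/
def equivNat : Tr ≃ ℕ := ⟨enc, dec, dec_enc, enc_dec⟩

instance : Primcodable Tr := Primcodable.ofEquiv ℕ equivNat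

theorem primrec_enc : Primrec enc := Primrec.of_equiv (e := equivNat)

theorem primrec_dec : Primrec dec := Primrec.of_equiv_symm (e := equivNat)

variable {α : Type} [Primcodable α]

theorem primrec_leaf {f : α → ℕ} (hf : Primrec f) : Primrec fun x => leaf (f x) :=
  (Primrec.of_equiv_iff equivNat).1 (Primrec.nat_mul.comp (.const 2) hf)

theorem primrec_node {f : α → ℕ} {g h : α → Tr} (hf : Primrec f) (hg : Primrec g)
    (hh : Primrec h) : Primrec fun x => node (f x) (g x) (h x) :=
  (Primrec.of_equiv_iff equivNat).1 (Primrec.succ.comp (Primrec.nat_mul.comp (.const 2)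
    (Primrec₂.natPair.comp hf
      (Primrec₂.natPair.comp (primrec_enc.comp hg) (primrec_enc.comp hh)))))

theorem enc_left_lt (n : ℕ) (a b : Tr) : a.enc < (node n a b).enc := by
  have h1 := Nat.left_le_pair a.enc b.enc
  have h2 := Nat.right_le_pair n (Nat.pair a.enc b.enc)
  rw [enc]
  omega

theorem enc_right_lt (n : ℕ) (a b : Tr) : b.enc < (node n a b).enc := by
  have h1 := Nat.right_le_pair a.enc b.enc
  have h2 := Nat.right_le_pair n (Nat.pair a.enc b.enc)
  rw [enc]
  omega

/-- Substitution of the constant `i` for the variable `k`. -/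
def sub (k i : ℕ) : Tr → Tr
  | leaf n => if n = 2 * k then leaf (2 * i + 1) else leaf n
  | node n a b => if n = k + 4 then node n a b else node n (sub k i a) (sub k i b)

section Semantics

variable {M : Type} [LA.Structure M]

/-- The value of a tree as a term. -/
def val (V : ℕ → M) : Tr → M
  | leaf n => V n
  | node 0 _ _ => zeroM M
  | node 1 a _ => succM (val V a)
  | node 2 a b => addM (val V a) (val V b)
  | node 3 a b => mulM (val V a) (val V b)
  | node (_ + 4) _ _ => zeroM M

/-- The truth value of a tree as a formula. -/
def holds : Tr → (ℕ → M) → Prop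
  | leaf _, _ => False
  | node 0 a b, V => val V a = val V b
  | node 1 a b, V => leM (val V a) (val V b)
  | node 2 a b, V => holds a V → holds b V
  | node 3 _ _, _ => False
  | node (k + 4) a _, V => ∀ x, holds a (Function.update V (2 * k) x)

theorem val_sub (V : ℕ → M) (k i : ℕ) (t : Tr) :
    val V (sub k i t) = val (Function.update V (2 * k) (V (2 * i + 1))) t := by
  induction t with
  | leaf n =>
    rw [sub, val]
    split_ifs with h
    · rw [h, Function.update_self, val]
    · rw [Function.update_of_ne h, val]
  | node n a b iha ihb =>
    rcases n with _ | _ | _ | _ | n <;> simp [sub, val, iha, ihb]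
    split_ifs <;> simp [val]

theorem holds_sub (k i : ℕ) (t : Tr) : ∀ V : ℕ → M,
    holds (sub k i t) V ↔ holds t (Function.update V (2 * k) (V (2 * i + 1))) := by
  induction t with
  | leaf n =>
    intro V
    rw [sub]
    split_ifs <;> simp [holds]
  | node n a b iha ihb =>
    intro V
    rcases n with _ | _ | _ | _ | n <;> simp [sub, holds, val_sub, iha, ihb]
    split_ifs with h
    · subst h
      simp [holds]
    · simp only [holds, iha]
      refine forall_congr' fun x => ?_
      rw [Function.update_of_ne (by omega), Function.update_comm (by omega)]

theorem val_congr {V V' : ℕ → M} (t : Tr) (h : ∀ n, n % 2 = 0 ∨ n / 2 < t.enc → V n = V' n) :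
    val V t = val V' t := by
  induction t with
  | leaf n =>
    refine h n ?_
    rw [enc]
    omega
  | node n a b iha ihb =>
    have ha := iha fun m hm => h m (hm.imp_right fun hm => hm.trans (enc_left_lt n a b))
    have hb := ihb fun m hm => h m (hm.imp_right fun hm => hm.trans (enc_right_lt n a b))
    rcases n with _ | _ | _ | _ | n <;> simp [val, ha, hb]

theorem holds_congr (t : Tr) : ∀ {V V' : ℕ → M},
    (∀ n, n % 2 = 0 ∨ n / 2 < t.enc → V n = V' n) → (holds t V ↔ holds t V') := by
  induction t with
  | leaf n => intros; rfl
  | node n a b iha ihb =>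
    intro V V' h
    have ha : ∀ m, m % 2 = 0 ∨ m / 2 < a.enc → V m = V' m := fun m hm =>
      h m (hm.imp_right fun hm => hm.trans (enc_left_lt n a b))
    have hb : ∀ m, m % 2 = 0 ∨ m / 2 < b.enc → V m = V' m := fun m hm =>
      h m (hm.imp_right fun hm => hm.trans (enc_right_lt n a b))
    rcases n with _ | _ | _ | _ | n
    · simp [holds, val_congr a ha, val_congr b hb]
    · simp [holds, val_congr a ha, val_congr b hb]
    · simp [holds, iha ha, ihb hb]
    · simp [holds]
    · simp only [holds]
      refine forall_congr' fun x => iha fun m hm => ?_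
      by_cases hmn : m = 2 * n
      · rw [hmn, Function.update_self, Function.update_self]
      · rw [Function.update_of_ne hmn, Function.update_of_ne hmn, ha m hm]

/-- The intended value of the constant named after the tree `t`: a counterexample if `t` is a
universal formula, and the value of `t` as a term otherwise. -/
noncomputable def witness (V : ℕ → M) : Tr → M
  | node (k + 4) a _ => @Classical.epsilon M ⟨V 0⟩ fun x => ¬ holds a (Function.update V (2 * k) x)
  | t => val V t

theorem witness_congr {V V' : ℕ → M} (t : Tr)
    (h : ∀ n, n % 2 = 0 ∨ n / 2 < t.enc → V n = V' n) : witness V t = witness V' t := by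
  rcases t with n | ⟨n, a, b⟩
  · exact val_congr _ h
  · rcases n with _ | _ | _ | _ | n
    · exact val_congr _ h
    · exact val_congr _ h
    · exact val_congr _ h
    · exact val_congr _ h
    · have key : (fun x => ¬ holds a (Function.update V (2 * n) x)) =
          fun x => ¬ holds a (Function.update V' (2 * n) x) := by
        funext x
        refine propext (not_congr (holds_congr a fun m hm => ?_))
        by_cases hmn : m = 2 * n
        · rw [hmn, Function.update_self, Function.update_self]
        · rw [Function.update_of_ne hmn, Function.update_of_ne hmn,
            h m (hm.imp_right fun hm => hm.trans (enc_left_lt _ a b))]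
      simp only [witness, key]

/-- The values of the constants under a given assignment of the variables. -/
noncomputable def constVal (V : ℕ → M) (j : ℕ) : M :=
  witness (fun n => if n % 2 = 0 then V n else if _ : n / 2 < j then constVal V (n / 2) else V 0)
    (dec j)

/-- The assignment extending an assignment of the variables to all constants. -/
noncomputable def fullEnv (V : ℕ → M) (n : ℕ) : M :=
  if n % 2 = 0 then V n else constVal V (n / 2)

theorem fullEnv_const (V : ℕ → M) (t : Tr) :
    fullEnv V (2 * t.enc + 1) = witness (fullEnv V) t := by
  have h : (2 * t.enc + 1) / 2 = t.enc := by omega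
  rw [fullEnv, if_neg (by omega), h, constVal, dec_enc]
  refine witness_congr _ fun n hn => ?_
  rw [fullEnv]
  split_ifs <;> simp_all

end Semantics

end Tr

/-! ### Translation of formulas into trees -/

/-- The tree of a term. -/
def trTerm {k : ℕ} : LA.Term (Empty ⊕ Fin k) → Tr
  | .var (.inr i) => .leaf (2 * i)
  | .func (l := _) f ts => match f, ts with
    | ArithFunc.zero, _ => .node 0 (.leaf 0) (.leaf 0)
    | ArithFunc.succ, ts => .node 1 (trTerm (ts 0)) (.leaf 0)
    | ArithFunc.add, ts => .node 2 (trTerm (ts 0)) (trTerm (ts 1))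
    | ArithFunc.mul, ts => .node 3 (trTerm (ts 0)) (trTerm (ts 1))

/-- The tree of a formula. -/
def tr : ∀ {k : ℕ}, LA.BoundedFormula Empty k → Tr
  | _, .falsum => .leaf 0
  | _, .equal t s => .node 0 (trTerm t) (trTerm s)
  | _, .rel (l := _) R ts => match R, ts with
    | ArithRel.le, ts => .node 1 (trTerm (ts 0)) (trTerm (ts 1))
  | _, .imp φ ψ => .node 2 (tr φ) (tr ψ)
  | k, .all φ => .node (k + 4) (tr φ) (.leaf 0)

theorem val_trTerm {M : Type} [LA.Structure M] {k : ℕ} (V : ℕ → M) (e : Empty → M)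
    (t : LA.Term (Empty ⊕ Fin k)) :
    (trTerm t).val V = t.realize (Sum.elim e fun i : Fin k => V (2 * i)) := by
  induction t with
  | var x =>
    rcases x with x | i
    · exact x.elim
    · rfl
  | func f ts ih =>
    cases f with
    | zero =>
      simp only [trTerm, Tr.val, Term.realize]
      exact congrArg (Structure.funMap (L := LA) ArithFunc.zero) (Subsingleton.elim _ _)
    | succ =>
      simp only [trTerm, Tr.val, Term.realize, ih]
      refine congrArg (Structure.funMap (L := LA) ArithFunc.succ) (funext fun i => ?_)
      rw [Subsingleton.elim i 0]
      rfl
    | add =>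
      simp only [trTerm, Tr.val, Term.realize, ih]
      refine congrArg (Structure.funMap (L := LA) ArithFunc.add) (funext fun i => ?_)
      fin_cases i <;> rfl
    | mul =>
      simp only [trTerm, Tr.val, Term.realize, ih]
      refine congrArg (Structure.funMap (L := LA) ArithFunc.mul) (funext fun i => ?_)
      fin_cases i <;> rfl

theorem holds_tr {M : Type} [LA.Structure M] (e : Empty → M) {k : ℕ}
    (φ : LA.BoundedFormula Empty k) : ∀ V : ℕ → M,
    (tr φ).holds V ↔ φ.Realize e fun i => V (2 * i) := by
  induction φ with
  | falsum => exact fun V => Iff.rfl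
  | equal t s =>
    intro V
    simp only [tr, Tr.holds, val_trTerm V e, BoundedFormula.Realize]
  | rel R ts =>
    intro V
    cases R with
    | le =>
      simp only [tr, Tr.holds, val_trTerm V e, BoundedFormula.Realize]
      refine iff_of_eq (congrArg (Structure.RelMap (L := LA) ArithRel.le) (funext fun i => ?_))
      fin_cases i <;> rfl
  | imp φ ψ ih₁ ih₂ =>
    intro V
    simp only [tr, Tr.holds, ih₁, ih₂, BoundedFormula.Realize]
  | @all k φ ih =>
    intro V
    simp only [tr, Tr.holds, ih, BoundedFormula.Realize]
    refine forall_congr' fun x => iff_of_eq (congrArg _ ?_)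
    funext i
    refine Fin.lastCases ?_ (fun j => ?_) i
    · simp
    · have := j.isLt
      rw [Fin.snoc_castSucc, Function.update_of_ne (by simp; omega), Fin.val_castSucc]

/-! ### A Hilbert calculus on syntax trees -/

open Tr

/-- The axioms of the calculus; `leaf 0` is the false formula, `node 2` is implication, and
`leaf (2 * i + 1)` is the constant `i`. The constant whose index is the code of a universal
formula is a Henkin witness for it, and the other constants name terms. -/
inductive Ax : Tr → Prop
  | k (a b : Tr) : Ax (node 2 a (node 2 b a))
  | s (a b c : Tr) :
      Ax (node 2 (node 2 a (node 2 b c)) (node 2 (node 2 a b) (node 2 a c)))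
  | dne (a : Tr) : Ax (node 2 (node 2 (node 2 a (leaf 0)) (leaf 0)) a)
  | leaf_false (n : ℕ) : Ax (node 2 (leaf n) (leaf 0))
  | node_false (a b : Tr) : Ax (node 2 (node 3 a b) (leaf 0))
  | inst (k i : ℕ) (a b : Tr) : Ax (node 2 (node (k + 4) a b) (sub k i a))
  | henkin (k : ℕ) (a b : Tr) :
      Ax (node 2 (sub k (node (k + 4) a b).enc a) (node (k + 4) a b))
  | eq_refl (a : Tr) : Ax (node 0 a a)
  | eq_symm (a b : Tr) : Ax (node 2 (node 0 a b) (node 0 b a))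
  | eq_trans (a b c : Tr) : Ax (node 2 (node 0 a b) (node 2 (node 0 b c) (node 0 a c)))
  | succ_congr (a b c d : Tr) : Ax (node 2 (node 0 a b) (node 0 (node 1 a c) (node 1 b d)))
  | func_congr (n : ℕ) (a b c d : Tr) :
      Ax (node 2 (node 0 a b) (node 2 (node 0 c d) (node 0 (node n a c) (node n b d))))
  | le_congr (a b c d : Tr) :
      Ax (node 2 (node 0 a b) (node 2 (node 0 c d) (node 2 (node 1 a c) (node 1 b d))))
  | zero_eq (a b : Tr) : Ax (node 0 (node 0 a b) (node 0 (leaf 0) (leaf 0)))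
  | all_eq (k : ℕ) (a b : Tr) : Ax (node 0 (node (k + 4) a b) (node 0 (leaf 0) (leaf 0)))
  | name_leaf (n : ℕ) : Ax (node 0 (leaf n) (leaf (2 * (leaf n).enc + 1)))
  | name_node (n : ℕ) (hn : n < 4) (a b : Tr) :
      Ax (node 0 (node n a b) (leaf (2 * (node n a b).enc + 1)))

/-- Derivability from the hypotheses `Γ`. -/
def Prov (Γ : Tr → Prop) : Tr → Prop :=
  Gen (fun t => Γ t ∨ Ax t) fun y z x => z = node 2 y x

/-! ### Soundness -/

theorem Ax.holds_fullEnv {M : Type} [LA.Structure M] (V : ℕ → M) {t : Tr} (h : Ax t) :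
    t.holds (fullEnv V) := by
  cases h with
  | k a b => exact fun h _ => h
  | s a b c => exact fun h h' h'' => h h'' (h' h'')
  | dne a => exact fun h => not_not.1 h
  | leaf_false n => exact id
  | node_false a b => exact id
  | inst k i a b => exact fun h => (holds_sub k i a _).2 (h _)
  | henkin k a b =>
    intro h x
    rw [holds_sub, fullEnv_const] at h
    by_contra hx
    exact @Classical.epsilon_spec M (fun x => ¬ a.holds (Function.update (fullEnv V) (2 * k) x))
      ⟨x, hx⟩ h
  | eq_refl a => exact (rfl : val (fullEnv V) a = val (fullEnv V) a)
  | eq_symm a b => exact fun (h : val _ a = val _ b) => h.symm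
  | eq_trans a b c => exact fun (h : val _ a = val _ b) (h' : val _ b = val _ c) => h.trans h'
  | succ_congr a b c d =>
    intro (h : val _ a = val _ b)
    simp only [holds, val, h]
  | func_congr n a b c d =>
    intro (h : val _ a = val _ b) (h' : val _ c = val _ d)
    rcases n with _ | _ | _ | _ | n <;> simp only [holds, val, h, h']
  | le_congr a b c d =>
    intro (h : val _ a = val _ b) (h' : val _ c = val _ d)
    simp only [holds, h, h', imp_self]
  | zero_eq a b => simp only [holds, val]
  | all_eq k a b => simp only [holds, val]
  | name_leaf n =>
    simp only [holds]
    exact (fullEnv_const V (leaf n)).symm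
  | name_node n hn a b =>
    simp only [holds]
    refine Eq.trans ?_ (fullEnv_const V (node n a b)).symm
    rcases n with _ | _ | _ | _ | n
    · rfl
    · rfl
    · rfl
    · rfl
    · omega

theorem Prov.holds_fullEnv {M : Type} [LA.Structure M] {V : ℕ → M} {Γ : Tr → Prop}
    (hΓ : ∀ t, Γ t → t.holds (fullEnv V)) {t : Tr} (h : Prov Γ t) : t.holds (fullEnv V) := by
  induction h with
  | base h => exact h.elim (hΓ _) (Ax.holds_fullEnv V)
  | step _ _ h ih₁ ih₂ =>
    subst h
    exact ih₂ ih₁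

/-! ### Completeness -/

namespace Prov

variable {Γ : Tr → Prop} {a b c : Tr}

theorem ax (h : Ax a) : Prov Γ a := .base (Or.inr h)

theorem hyp (h : Γ a) : Prov Γ a := .base (Or.inl h)

theorem mp (h : Prov Γ (node 2 a b)) (h' : Prov Γ a) : Prov Γ b := .step h' h rfl

theorem mono {Δ : Tr → Prop} (h : Prov Γ a) (H : ∀ t, Γ t → Δ t) : Prov Δ a := by
  induction h with
  | base h => exact .base (h.imp_left (H _))
  | step _ _ h ih₁ ih₂ => exact .step ih₁ ih₂ h

theorem imp_self (a : Tr) : Prov Γ (node 2 a a) :=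
  mp (mp (ax (.s a (node 2 a a) a)) (ax (.k _ _))) (ax (.k a a))

theorem deduction (h : Prov (fun t => Γ t ∨ t = a) b) : Prov Γ (node 2 a b) := by
  induction h with
  | base h =>
    rcases h with (h | rfl) | h
    · exact mp (ax (.k _ _)) (hyp h)
    · exact imp_self _
    · exact mp (ax (.k _ _)) (ax h)
  | step _ _ h ih₁ ih₂ =>
    subst h
    exact mp (mp (ax (.s _ _ _)) ih₂) ih₁

theorem exists_finite (h : Prov Γ a) :
    ∃ s : Set Tr, s.Finite ∧ (∀ t ∈ s, Γ t) ∧ Prov (· ∈ s) a := by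
  induction h with
  | @base x h =>
    rcases h with h | h
    · exact ⟨{x}, Set.finite_singleton x, by simpa using h, hyp rfl⟩
    · exact ⟨∅, Set.finite_empty, by simp, ax h⟩
  | step _ _ h ih₁ ih₂ =>
    obtain ⟨s, hs, hsΓ, h₁⟩ := ih₁
    obtain ⟨s', hs', hsΓ', h₂⟩ := ih₂
    subst h
    exact ⟨s ∪ s', hs.union hs', fun t ht => ht.elim (hsΓ t) (hsΓ' t),
      mp (h₂.mono fun _ => Or.inr) (h₁.mono fun _ => Or.inl)⟩

end Prov

/-- A deductively closed, consistent and negation complete set of trees. -/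
structure MaxCons (D : Tr → Prop) : Prop where
  ax {a : Tr} : Ax a → D a
  mp {a b : Tr} : D (node 2 a b) → D a → D b
  cons : ¬ D (leaf 0)
  compl {a : Tr} : ¬ D a → D (node 2 a (leaf 0))

theorem exists_maxCons {Γ : Tr → Prop} (h : ¬ Prov Γ (leaf 0)) :
    ∃ D, MaxCons D ∧ ∀ t, Γ t → D t := by
  obtain ⟨Δ, hΓΔ, hΔ⟩ := zorn_subset_nonempty {Δ : Set Tr | ¬ Prov (· ∈ Δ) (leaf 0)} (by
    intro C hC hchain hne
    refine ⟨⋃₀ C, fun hU => ?_, fun s hs => Set.subset_sUnion_of_mem hs⟩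
    obtain ⟨s, hs, hsC, hp⟩ := hU.exists_finite
    obtain ⟨t, ht, hst⟩ :=
      hchain.directedOn.exists_mem_subset_of_finite_of_subset_sUnion hne hs hsC
    exact hC ht (hp.mono hst)) {t | Γ t} h
  refine ⟨Prov (· ∈ Δ), ⟨.ax, .mp, hΔ.prop, fun {a} ha => Prov.deduction ?_⟩,
    fun t ht => .hyp (hΓΔ ht)⟩
  by_contra hcon
  refine ha (.hyp (hΔ.le_of_ge (y := {t | t ∈ Δ ∨ t = a}) hcon (fun t ht => Or.inl ht) ?_))
  exact Or.inr rfl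

namespace MaxCons

variable {D : Tr → Prop} (hD : MaxCons D)

theorem imp_iff (hD : MaxCons D) {a b : Tr} : D (node 2 a b) ↔ (D a → D b) := by
  refine ⟨hD.mp, fun h => ?_⟩
  by_cases ha : D a
  · exact hD.mp (hD.ax (.k _ _)) (h ha)
  · refine hD.mp (hD.mp (hD.ax (.s a (node 2 (node 2 b (leaf 0)) (leaf 0)) b))
      (hD.mp (hD.ax (.k _ _)) (hD.ax (.dne b)))) ?_
    exact hD.mp (hD.mp (hD.ax (.s _ (leaf 0) _)) (hD.mp (hD.ax (.k _ _)) (hD.ax (.k _ _))))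
      (hD.compl ha)

/-- Provable equality of trees as terms. -/
def setoid (hD : MaxCons D) : Setoid Tr where
  r a b := D (node 0 a b)
  iseqv :=
    { refl := fun a => hD.ax (.eq_refl a)
      symm := fun h => hD.mp (hD.ax (.eq_symm _ _)) h
      trans := fun h h' => hD.mp (hD.mp (hD.ax (.eq_trans _ _ _)) h) h' }

/-- The domain of the term model. -/
def Model (hD : MaxCons D) : Type := Quotient hD.setoid

/-- The element of the term model given by a tree. -/
def cls (t : Tr) : hD.Model := Quotient.mk hD.setoid t

theorem cls_eq_cls {a b : Tr} : hD.cls a = hD.cls b ↔ D (node 0 a b) :=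
  Quotient.eq (r := hD.setoid)

noncomputable instance : LA.Structure hD.Model where
  funMap {_} f := match f with
    | ArithFunc.zero => fun _ => hD.cls (node 0 (leaf 0) (leaf 0))
    | ArithFunc.succ => fun v => hD.cls (node 1 (v 0).out (leaf 0))
    | ArithFunc.add => fun v => hD.cls (node 2 (v 0).out (v 1).out)
    | ArithFunc.mul => fun v => hD.cls (node 3 (v 0).out (v 1).out)
  RelMap {_} r := match r with
    | ArithRel.le => fun v => D (node 1 (v 0).out (v 1).out)

theorem out_eq (t : Tr) : D (node 0 (hD.cls t).out t) :=
  Quotient.mk_out (s := hD.setoid) t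

theorem eq_out (t : Tr) : D (node 0 t (hD.cls t).out) := hD.mp (hD.ax (.eq_symm _ _)) (hD.out_eq t)

theorem val_eq (t : Tr) : val (fun n => hD.cls (leaf n)) t = hD.cls t := by
  induction t with
  | leaf n => rfl
  | node n a b iha ihb =>
    rcases n with _ | _ | _ | _ | n
    · exact hD.cls_eq_cls.2 (hD.mp (hD.ax (.eq_symm _ _)) (hD.ax (.zero_eq a b)))
    · rw [val, iha]
      exact hD.cls_eq_cls.2 (hD.mp (hD.ax (.succ_congr _ _ _ _)) (hD.out_eq a))
    · rw [val, iha, ihb]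
      exact hD.cls_eq_cls.2 (hD.mp (hD.mp (hD.ax (.func_congr _ _ _ _ _)) (hD.out_eq a))
        (hD.out_eq b))
    · rw [val, iha, ihb]
      exact hD.cls_eq_cls.2 (hD.mp (hD.mp (hD.ax (.func_congr _ _ _ _ _)) (hD.out_eq a))
        (hD.out_eq b))
    · exact hD.cls_eq_cls.2 (hD.mp (hD.ax (.eq_symm _ _)) (hD.ax (.all_eq n a b)))

theorem exists_const (x : hD.Model) : ∃ i : ℕ, x = hD.cls (leaf (2 * i + 1)) := by
  obtain ⟨t, rfl⟩ : ∃ t, hD.cls t = x := Quotient.exists_rep x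
  rcases t with n | ⟨n, a, b⟩
  · exact ⟨_, hD.cls_eq_cls.2 (hD.ax (.name_leaf n))⟩
  · by_cases hn : n < 4
    · exact ⟨_, hD.cls_eq_cls.2 (hD.ax (.name_node n hn a b))⟩
    · obtain ⟨k, rfl⟩ := Nat.exists_eq_add_of_le' (not_lt.1 hn)
      exact ⟨_, (hD.cls_eq_cls.2 (hD.ax (.all_eq k a b))).trans
        (hD.cls_eq_cls.2 (hD.ax (.name_node 0 (by omega) _ _)))⟩

end MaxCons

/-- The number of nodes of a tree. -/
def Tr.size : Tr → ℕ
  | leaf _ => 0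
  | node _ a b => a.size + b.size + 1

theorem Tr.size_sub (k i : ℕ) (t : Tr) : (sub k i t).size = t.size := by
  induction t with
  | leaf n => rw [sub]; split_ifs <;> rfl
  | node n a b iha ihb => rw [sub]; split_ifs <;> simp [size, iha, ihb]

theorem MaxCons.holds_iff {D : Tr → Prop} (hD : MaxCons D) (t : Tr) :
    t.holds (fun n => hD.cls (leaf n)) ↔ D t := by
  induction h : t.size using Nat.strong_induction_on generalizing t with
  | _ d ih =>
    subst h
    rcases t with n | ⟨n, a, b⟩
    · exact ⟨False.elim, fun h => hD.cons (hD.mp (hD.ax (.leaf_false n)) h)⟩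
    · have ha : a.size < (node n a b).size := by simp only [Tr.size]; omega
      have hb : b.size < (node n a b).size := by simp only [Tr.size]; omega
      rcases n with _ | _ | _ | _ | k
      · rw [holds, hD.val_eq, hD.val_eq, hD.cls_eq_cls]
      · rw [holds, hD.val_eq, hD.val_eq]
        exact ⟨hD.mp (hD.mp (hD.mp (hD.ax (.le_congr _ _ _ _)) (hD.out_eq a)) (hD.out_eq b)),
          hD.mp (hD.mp (hD.mp (hD.ax (.le_congr _ _ _ _)) (hD.eq_out a)) (hD.eq_out b))⟩
      · rw [holds, ih _ ha a rfl, ih _ hb b rfl, hD.imp_iff]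
      · exact ⟨False.elim, fun h => hD.cons (hD.mp (hD.ax (.node_false a b)) h)⟩
      · have key : ∀ i, D (sub k i a) ↔ a.holds
            (Function.update (fun n => hD.cls (leaf n)) (2 * k) (hD.cls (leaf (2 * i + 1)))) := by
          intro i
          rw [← holds_sub k i a fun n => hD.cls (leaf n)]
          exact (ih _ (by rwa [size_sub]) _ rfl).symm
        rw [holds]
        constructor
        · intro h
          exact hD.mp (hD.ax (.henkin k a b)) ((key _).2 (h _))
        · intro h x
          obtain ⟨i, rfl⟩ := hD.exists_const x
          exact (key i).1 (hD.mp (hD.ax (.inst k i a b)) h)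

theorem proves_iff_prov (T : LA.Theory) (φ : LA.Sentence) :
    Proves T φ ↔ Prov (fun t => ∃ ψ ∈ T, t = tr ψ) (tr φ) := by
  rw [Proves, Theory.models_sentence_iff]
  constructor
  · intro h
    by_contra hφ
    have hcon : ¬ Prov (fun t => (∃ ψ ∈ T, t = tr ψ) ∨ t = node 2 (tr φ) (leaf 0)) (leaf 0) :=
      fun hp => hφ (.mp (.ax (.dne _)) hp.deduction)
    obtain ⟨D, hD, hΓ⟩ := exists_maxCons hcon
    have hholds : ∀ ψ : LA.Sentence, hD.Model ⊨ ψ ↔ D (tr ψ) := fun ψ => by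
      rw [← hD.holds_iff, holds_tr default, Sentence.Realize, Formula.Realize]
      exact iff_of_eq (congrArg _ (Subsingleton.elim _ _))
    have : Nonempty hD.Model := ⟨hD.cls (leaf 0)⟩
    have : hD.Model ⊨ T := ⟨fun ψ hψ => (hholds ψ).2 (hΓ _ (Or.inl ⟨ψ, hψ, rfl⟩))⟩
    exact hD.cons (hD.mp (hΓ _ (Or.inr rfl)) ((hholds φ).1 (h (Theory.ModelType.of T hD.Model))))
  · intro h M
    obtain ⟨x⟩ : Nonempty M := inferInstance
    have hholds : ∀ ψ : LA.Sentence, M ⊨ ψ ↔ (tr ψ).holds (fullEnv fun _ => x) := fun ψ => by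
      rw [holds_tr default, Sentence.Realize, Formula.Realize]
      exact iff_of_eq (congrArg _ (Subsingleton.elim _ _))
    refine (hholds φ).2 (h.holds_fullEnv ?_)
    rintro _ ⟨ψ, hψ, rfl⟩
    exact (hholds ψ).1 (Theory.realize_sentence_of_mem T hψ)

/-! ### Arithmetization of the calculus -/

section Primrec

variable {α β : Type} [Primcodable α] [Primcodable β]

theorem primrec_add {f g : α → ℕ} (hf : Primrec f) (hg : Primrec g) :
    Primrec fun x => f x + g x := Primrec.nat_add.comp hf hg

theorem primrec_mul {f g : α → ℕ} (hf : Primrec f) (hg : Primrec g) :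
    Primrec fun x => f x * g x := Primrec.nat_mul.comp hf hg

theorem primrec_pair {f g : α → ℕ} (hf : Primrec f) (hg : Primrec g) :
    Primrec fun x => Nat.pair (f x) (g x) := Primrec₂.natPair.comp hf hg

theorem primrec_cons {f : α → β} {g : α → List β} (hf : Primrec f) (hg : Primrec g) :
    Primrec fun x => f x :: g x := Primrec.list_cons.comp hf hg

theorem primrec_append {f g : α → List β} (hf : Primrec f) (hg : Primrec g) :
    Primrec fun x => f x ++ g x := Primrec.list_append.comp hf hg

end Primrec

attribute [local fun_prop] primrec_add primrec_mul primrec_pair primrec_cons primrec_append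
  Tr.primrec_leaf Tr.primrec_node Tr.primrec_enc Primrec.encode

theorem sd_sub (n : ℕ) :
    SD n fun p : (ℕ × ℕ) × Tr × Tr => p.2.2 = sub p.1.1 p.1.2 p.2.1 := by
  have hI : SD n fun x : (ℕ × ℕ) × Tr × Tr =>
      (∃ p : ℕ × ℕ, x = (p, leaf (2 * p.1), leaf (2 * p.2 + 1))) ∨
      (∃ p : (ℕ × ℕ) × ℕ, ¬ p.2 = 2 * p.1.1 ∧ x = (p.1, leaf p.2, leaf p.2)) ∨
      ∃ p : (ℕ × ℕ) × Tr × Tr,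
        x = (p.1, node (p.1.1 + 4) p.2.1 p.2.2, node (p.1.1 + 4) p.2.1 p.2.2) :=
    .or (.range' (by fun_prop)) (.or (.range (.of_primrecPred
      (Primrec.eq.comp (by fun_prop) (by fun_prop)).not) (by fun_prop)) (.range' (by fun_prop)))
  have hS : SD n fun q : ((ℕ × ℕ) × Tr × Tr) × ((ℕ × ℕ) × Tr × Tr) × ((ℕ × ℕ) × Tr × Tr) =>
      ∃ m : ℕ, ¬ m = q.1.1.1 + 4 ∧ q.2.1.1 = q.1.1 ∧
        q.2.2 = (q.1.1, node m q.1.2.1 q.2.1.2.1, node m q.1.2.2 q.2.1.2.2) :=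
    .ex (.and (.of_primrecPred (Primrec.eq.comp (by fun_prop) (by fun_prop)).not)
      (.and (.eq (by fun_prop) (by fun_prop)) (.eq (by fun_prop) (by fun_prop))))
  refine (SD.gen (S := fun y z x => ∃ m : ℕ, ¬ m = y.1.1 + 4 ∧ z.1 = y.1 ∧
        x = (y.1, node m y.2.1 z.2.1, node m y.2.2 z.2.2)) hI hS).congr fun x => ⟨fun h => ?_, ?_⟩
  · induction h with
    | base h =>
      rcases h with ⟨p, rfl⟩ | ⟨p, h, rfl⟩ | ⟨p, rfl⟩
      · simp [sub]
      · simp [sub, h]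
      · simp [sub]
    | step _ _ h ih₁ ih₂ =>
      obtain ⟨m, hm, hz, rfl⟩ := h
      rw [hz] at ih₂
      simp [sub, hm, ih₁, ih₂]
  · obtain ⟨⟨k, i⟩, t, t'⟩ := x
    intro h
    change t' = sub k i t at h
    subst h
    induction t with
    | leaf m =>
      by_cases hm : m = 2 * k
      · subst hm
        exact .base (Or.inl ⟨(k, i), by simp [sub]⟩)
      · exact .base (Or.inr (Or.inl ⟨((k, i), m), hm, by simp [sub, hm]⟩))
    | node m a b iha ihb =>
      by_cases hm : m = k + 4
      · subst hm
        exact .base (Or.inr (Or.inr ⟨((k, i), a, b), by simp [sub]⟩))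
      · exact .step iha ihb ⟨m, hm, rfl, by simp [sub, hm]⟩

theorem sd_ax (n : ℕ) : SD n Ax := by
  have h : SD n fun t : Tr =>
      (∃ p : Tr × Tr, t = node 2 p.1 (node 2 p.2 p.1)) ∨
      (∃ p : Tr × Tr × Tr, t = node 2 (node 2 p.1 (node 2 p.2.1 p.2.2))
        (node 2 (node 2 p.1 p.2.1) (node 2 p.1 p.2.2))) ∨
      (∃ a : Tr, t = node 2 (node 2 (node 2 a (leaf 0)) (leaf 0)) a) ∨
      (∃ m : ℕ, t = node 2 (leaf m) (leaf 0)) ∨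
      (∃ p : Tr × Tr, t = node 2 (node 3 p.1 p.2) (leaf 0)) ∨
      (∃ p : ((ℕ × ℕ) × Tr × Tr) × Tr, p.1.2.2 = sub p.1.1.1 p.1.1.2 p.1.2.1 ∧
        t = node 2 (node (p.1.1.1 + 4) p.1.2.1 p.2) p.1.2.2) ∨
      (∃ p : (ℕ × Tr × Tr) × Tr, p.2 = sub p.1.1 (node (p.1.1 + 4) p.1.2.1 p.1.2.2).enc p.1.2.1 ∧
        t = node 2 p.2 (node (p.1.1 + 4) p.1.2.1 p.1.2.2)) ∨
      (∃ a : Tr, t = node 0 a a) ∨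
      (∃ p : Tr × Tr, t = node 2 (node 0 p.1 p.2) (node 0 p.2 p.1)) ∨
      (∃ p : Tr × Tr × Tr,
        t = node 2 (node 0 p.1 p.2.1) (node 2 (node 0 p.2.1 p.2.2) (node 0 p.1 p.2.2))) ∨
      (∃ p : (Tr × Tr) × Tr × Tr,
        t = node 2 (node 0 p.1.1 p.1.2) (node 0 (node 1 p.1.1 p.2.1) (node 1 p.1.2 p.2.2))) ∨
      (∃ p : ℕ × (Tr × Tr) × Tr × Tr, t = node 2 (node 0 p.2.1.1 p.2.1.2)
        (node 2 (node 0 p.2.2.1 p.2.2.2)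
          (node 0 (node p.1 p.2.1.1 p.2.2.1) (node p.1 p.2.1.2 p.2.2.2)))) ∨
      (∃ p : (Tr × Tr) × Tr × Tr, t = node 2 (node 0 p.1.1 p.1.2) (node 2 (node 0 p.2.1 p.2.2)
          (node 2 (node 1 p.1.1 p.2.1) (node 1 p.1.2 p.2.2)))) ∨
      (∃ p : Tr × Tr, t = node 0 (node 0 p.1 p.2) (node 0 (leaf 0) (leaf 0))) ∨
      (∃ p : ℕ × Tr × Tr, t = node 0 (node (p.1 + 4) p.2.1 p.2.2) (node 0 (leaf 0) (leaf 0))) ∨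
      (∃ m : ℕ, t = node 0 (leaf m) (leaf (2 * (leaf m).enc + 1))) ∨
      ∃ p : ℕ × Tr × Tr, p.1 < 4 ∧
        t = node 0 (node p.1 p.2.1 p.2.2) (leaf (2 * (node p.1 p.2.1 p.2.2).enc + 1)) := by
    refine .or (.range' (by fun_prop)) (.or (.range' (by fun_prop)) (.or (.range' (by fun_prop))
      (.or (.range' (by fun_prop)) (.or (.range' (by fun_prop)) (.or (.range ?_ (by fun_prop))
      (.or (.range ?_ (by fun_prop)) (.or (.range' (by fun_prop)) (.or (.range' (by fun_prop))
      (.or (.range' (by fun_prop)) (.or (.range' (by fun_prop)) (.or (.range' (by fun_prop))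
      (.or (.range' (by fun_prop)) (.or (.range' (by fun_prop)) (.or (.range' (by fun_prop))
      (.or (.range' (by fun_prop)) (.range (.lt (by fun_prop) (by fun_prop))
        (by fun_prop)))))))))))))))))
    · exact (sd_sub n).comp .fst
    · exact (sd_sub n).comp (f := fun p : (ℕ × Tr × Tr) × Tr =>
        ((p.1.1, (node (p.1.1 + 4) p.1.2.1 p.1.2.2).enc), p.1.2.1, p.2)) (by fun_prop)
  refine h.congr fun t => ⟨?_, fun h => ?_⟩
  · rintro (⟨p, rfl⟩ | ⟨p, rfl⟩ | ⟨p, rfl⟩ | ⟨p, rfl⟩ | ⟨p, rfl⟩ | ⟨p, h, rfl⟩ | ⟨p, h, rfl⟩ |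
      ⟨p, rfl⟩ | ⟨p, rfl⟩ | ⟨p, rfl⟩ | ⟨p, rfl⟩ | ⟨p, rfl⟩ | ⟨p, rfl⟩ | ⟨p, rfl⟩ | ⟨p, rfl⟩ |
      ⟨p, rfl⟩ | ⟨p, h, rfl⟩)
    · exact .k _ _
    · exact .s _ _ _
    · exact .dne _
    · exact .leaf_false _
    · exact .node_false _ _
    · exact h ▸ .inst _ _ _ _
    · exact h ▸ .henkin _ _ _
    · exact .eq_refl _
    · exact .eq_symm _ _
    · exact .eq_trans _ _ _
    · exact .succ_congr _ _ _ _
    · exact .func_congr _ _ _ _ _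
    · exact .le_congr _ _ _ _
    · exact .zero_eq _ _
    · exact .all_eq _ _ _
    · exact .name_leaf _
    · exact .name_node _ h _ _
  · cases h with
    | k a b => exact Or.inl ⟨(a, b), rfl⟩
    | s a b c => exact Or.inr (Or.inl ⟨(a, b, c), rfl⟩)
    | dne a => exact Or.inr (Or.inr (Or.inl ⟨a, rfl⟩))
    | leaf_false m => iterate 3 right
                      exact Or.inl ⟨m, rfl⟩
    | node_false a b => iterate 4 right
                        exact Or.inl ⟨(a, b), rfl⟩
    | inst k i a b => iterate 5 right
                      exact Or.inl ⟨(((k, i), a, _), b), rfl, rfl⟩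
    | henkin k a b => iterate 6 right
                      exact Or.inl ⟨((k, a, b), _), rfl, rfl⟩
    | eq_refl a => iterate 7 right
                   exact Or.inl ⟨a, rfl⟩
    | eq_symm a b => iterate 8 right
                     exact Or.inl ⟨(a, b), rfl⟩
    | eq_trans a b c => iterate 9 right
                        exact Or.inl ⟨(a, b, c), rfl⟩
    | succ_congr a b c d => iterate 10 right
                            exact Or.inl ⟨((a, b), c, d), rfl⟩
    | func_congr m a b c d => iterate 11 right
                              exact Or.inl ⟨(m, (a, b), c, d), rfl⟩
    | le_congr a b c d => iterate 12 right
                          exact Or.inl ⟨((a, b), c, d), rfl⟩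
    | zero_eq a b => iterate 13 right
                     exact Or.inl ⟨(a, b), rfl⟩
    | all_eq k a b => iterate 14 right
                      exact Or.inl ⟨(k, a, b), rfl⟩
    | name_leaf m => iterate 15 right
                     exact Or.inl ⟨m, rfl⟩
    | name_node m hm a b => iterate 16 right
                            exact ⟨(m, a, b), hm, rfl⟩

theorem sd_prov {n : ℕ} {Γ : Tr → Prop} (hΓ : SD n Γ) : SD n (Prov Γ) :=
  (hΓ.or (sd_ax n)).gen (.eq (by fun_prop) (by fun_prop))

/-! ### Recovering trees from Gödel numbers -/

/-- The list of codes of the entries of a list. -/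
def codes {α : Type} [Encodable α] (l : List α) : List ℕ := l.map Encodable.encode

theorem encode_codes {α : Type} [Encodable α] (l : List α) :
    Encodable.encode (codes l) = Encodable.encode l := by
  induction l with
  | nil => rfl
  | cons a l ih => rw [Encodable.encode_list_cons, ← ih]; rfl

/-- The rules generating the triples (context, tree, codes of symbols) of compound terms. -/
def TermStep (y z x : ℕ × Tr × List ℕ) : Prop :=
  x = (y.1, node 1 y.2.1 (leaf 0), 3 :: y.2.2) ∨
  (z.1 = y.1 ∧ x = (y.1, node 2 y.2.1 z.2.1, 5 :: (y.2.2 ++ z.2.2))) ∨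
  (z.1 = y.1 ∧ x = (y.1, node 3 y.2.1 z.2.1, 7 :: (y.2.2 ++ z.2.2)))

/-- The triples (context, tree, codes of symbols) of atomic terms. -/
def TermBase (x : ℕ × Tr × List ℕ) : Prop :=
  (∃ p : ℕ × ℕ, p.2 < p.1 ∧ x = (p.1, leaf (2 * p.2), [2 * (2 * p.2 + 1)])) ∨
  ∃ k : ℕ, x = (k, node 0 (leaf 0) (leaf 0), [1])

theorem codes_listEncode_func {k l : ℕ} (f : LA.Functions l)
    (ts : Fin l → LA.Term (Empty ⊕ Fin k)) :
    codes (Term.func f ts).listEncode =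
      (2 * Encodable.encode (⟨l, f⟩ : Σ i, LA.Functions i) + 1) ::
        (List.finRange l).flatMap fun i => codes (ts i).listEncode := by
  simp [codes, Term.listEncode, List.map_flatMap]

theorem gen_term_iff {k : ℕ} {τ : Tr} {l : List ℕ} :
    Gen TermBase TermStep (k, τ, l) ↔
      ∃ t : LA.Term (Empty ⊕ Fin k), τ = trTerm t ∧ l = codes t.listEncode := by
  constructor
  · generalize hx : (k, τ, l) = x
    intro h
    induction h generalizing k τ l with
    | base h =>
      rcases h with ⟨⟨k', i⟩, hi, rfl⟩ | ⟨k', rfl⟩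
      · obtain ⟨rfl, rfl, rfl⟩ := by simpa using hx
        exact ⟨.var (.inr ⟨i, hi⟩), rfl, rfl⟩
      · obtain ⟨rfl, rfl, rfl⟩ := by simpa using hx
        exact ⟨zeroT, rfl, rfl⟩
    | @step y z x _ _ h ihy ihz =>
      obtain ⟨k₁, τ₁, l₁⟩ := y
      obtain ⟨k₂, τ₂, l₂⟩ := z
      obtain ⟨t, rfl, rfl⟩ := ihy rfl
      rcases h with rfl | ⟨h, rfl⟩ | ⟨h, rfl⟩
      · obtain ⟨rfl, rfl, rfl⟩ := by simpa using hx
        refine ⟨succT t, rfl, ?_⟩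
        refine Eq.symm ((codes_listEncode_func ArithFunc.succ ![t]).trans ?_)
        simp [List.finRange_succ]
        rfl
      · obtain rfl : k₂ = k₁ := h
        obtain ⟨s, rfl, rfl⟩ := ihz rfl
        obtain ⟨rfl, rfl, rfl⟩ := by simpa using hx
        refine ⟨addT t s, rfl, ?_⟩
        refine Eq.symm ((codes_listEncode_func ArithFunc.add ![t, s]).trans ?_)
        simp [List.finRange_succ]
        rfl
      · obtain rfl : k₂ = k₁ := h
        obtain ⟨s, rfl, rfl⟩ := ihz rfl
        obtain ⟨rfl, rfl, rfl⟩ := by simpa using hx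
        refine ⟨mulT t s, rfl, ?_⟩
        refine Eq.symm ((codes_listEncode_func ArithFunc.mul ![t, s]).trans ?_)
        simp [List.finRange_succ]
        rfl
  · rintro ⟨t, rfl, rfl⟩
    induction t with
    | var x =>
      rcases x with e | i
      · exact e.elim
      · exact .base (Or.inl ⟨(k, i), i.2, rfl⟩)
    | func f ts ih =>
      rw [codes_listEncode_func]
      cases f with
      | zero => exact .base (Or.inr ⟨k, rfl⟩)
      | succ =>
        exact .step (ih 0) (ih 0) (Or.inl (by simp [trTerm, List.finRange_succ]; rfl))
      | add =>
        exact .step (ih 0) (ih 1) (Or.inr (Or.inl ⟨rfl, by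
          simp [trTerm, List.finRange_succ]; rfl⟩))
      | mul =>
        exact .step (ih 0) (ih 1) (Or.inr (Or.inr ⟨rfl, by
          simp [trTerm, List.finRange_succ]; rfl⟩))

theorem sd_gen_term (n : ℕ) : SD n (Gen TermBase TermStep) := by
  refine .gen (.or (.range (SD.lt .snd .fst) (by fun_prop)) (.range' (by fun_prop))) ?_
  exact .or (.eq (by fun_prop) (by fun_prop)) (.or
    (.and (.eq (by fun_prop) (by fun_prop)) (.eq (by fun_prop) (by fun_prop)))
    (.and (.eq (by fun_prop) (by fun_prop)) (.eq (by fun_prop) (by fun_prop))))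

/-- The triples (context, tree, codes of symbols) of atomic formulas. -/
def FormulaBase (x : ℕ × Tr × List ℕ) : Prop :=
  (∃ k : ℕ, x = (k, leaf 0, [4 * (k + 2) + 3])) ∨
  ∃ p : (ℕ × Tr × List ℕ) × (ℕ × Tr × List ℕ),
    (Gen TermBase TermStep p.1 ∧ Gen TermBase TermStep p.2 ∧ p.2.1 = p.1.1) ∧
    (x = (p.1.1, node 0 p.1.2.1 p.2.2.1, [2 * Nat.pair p.1.1 (Encodable.encode p.1.2.2),
        2 * Nat.pair p.1.1 (Encodable.encode p.2.2.2)]) ∨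
      x = (p.1.1, node 1 p.1.2.1 p.2.2.1, [1, 4 * p.1.1 + 3,
        2 * Nat.pair p.1.1 (Encodable.encode p.1.2.2),
        2 * Nat.pair p.1.1 (Encodable.encode p.2.2.2)]))

/-- The rules generating the triples (context, tree, codes of symbols) of compound formulas. -/
def FormulaStep (y z x : ℕ × Tr × List ℕ) : Prop :=
  (z.1 = y.1 ∧ x = (y.1, node 2 y.2.1 z.2.1, 3 :: (y.2.2 ++ z.2.2))) ∨
  ∃ k : ℕ, y.1 = k + 1 ∧ x = (k, node (k + 4) y.2.1 (leaf 0), 7 :: y.2.2)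

theorem sd_gen_formula (n : ℕ) : SD n (Gen FormulaBase FormulaStep) := by
  refine .gen (.or (.range' (by fun_prop)) (.ex (.and (.and ?_ (.and ?_ ?_)) (.or ?_ ?_))))
    (.or (.and ?_ ?_) (.ex (.and ?_ ?_)))
  · exact (sd_gen_term n).comp (by fun_prop)
  · exact (sd_gen_term n).comp (by fun_prop)
  all_goals exact .eq (by fun_prop) (by fun_prop)

theorem encode_sigma_term {k : ℕ} (t : LA.Term (Empty ⊕ Fin k)) :
    Encodable.encode (⟨k, t⟩ : Σ k, LA.Term (Empty ⊕ Fin k)) =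
      Nat.pair k (Encodable.encode (codes t.listEncode)) := by
  rw [encode_codes]
  rfl

theorem codes_listEncode_equal {k : ℕ} (t s : LA.Term (Empty ⊕ Fin k)) :
    codes (BoundedFormula.equal t s).listEncode =
      [2 * Nat.pair k (Encodable.encode (codes t.listEncode)),
        2 * Nat.pair k (Encodable.encode (codes s.listEncode))] := by
  simp only [← encode_sigma_term]
  rfl

theorem codes_listEncode_le {k : ℕ} (R : LA.Relations 2)
    (ts : Fin 2 → LA.Term (Empty ⊕ Fin k)) :
    codes (BoundedFormula.rel R ts).listEncode =
      [1, 4 * k + 3, 2 * Nat.pair k (Encodable.encode (codes (ts 0).listEncode)),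
        2 * Nat.pair k (Encodable.encode (codes (ts 1).listEncode))] := by
  have h : 4 * k + 3 = 2 * (2 * k + 1) + 1 := by ring
  simp only [← encode_sigma_term, h]
  rfl

theorem codes_listEncode_falsum {k : ℕ} :
    codes (BoundedFormula.falsum : LA.BoundedFormula Empty k).listEncode =
      [4 * (k + 2) + 3] := by
  have h : 4 * (k + 2) + 3 = 2 * (2 * (k + 2) + 1) + 1 := by ring
  rw [h]
  rfl

theorem codes_listEncode_imp {k : ℕ} (φ ψ : LA.BoundedFormula Empty k) :
    codes (φ.imp ψ).listEncode = 3 :: (codes φ.listEncode ++ codes ψ.listEncode) := by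
  simp [codes, listEncode]

theorem codes_listEncode_all {k : ℕ} (φ : LA.BoundedFormula Empty (k + 1)) :
    codes φ.all.listEncode = 7 :: codes φ.listEncode := by
  simp [codes, listEncode]

theorem gen_formula_iff {k : ℕ} {τ : Tr} {l : List ℕ} :
    Gen FormulaBase FormulaStep (k, τ, l) ↔
      ∃ φ : LA.BoundedFormula Empty k, τ = tr φ ∧ l = codes φ.listEncode := by
  constructor
  · generalize hx : (k, τ, l) = x
    intro h
    induction h generalizing k τ l with
    | base h =>
      rcases h with ⟨k', rfl⟩ | ⟨⟨⟨k₁, τ₁, l₁⟩, ⟨k₂, τ₂, l₂⟩⟩, ⟨h₁, h₂, h⟩, h'⟩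
      · obtain ⟨rfl, rfl, rfl⟩ := by simpa using hx
        exact ⟨.falsum, rfl, codes_listEncode_falsum.symm⟩
      · obtain rfl : k₂ = k₁ := h
        obtain ⟨t, rfl, rfl⟩ := gen_term_iff.1 h₁
        obtain ⟨s, rfl, rfl⟩ := gen_term_iff.1 h₂
        rcases h' with rfl | rfl
        · obtain ⟨rfl, rfl, rfl⟩ := by simpa using hx
          exact ⟨.equal t s, rfl, (codes_listEncode_equal t s).symm⟩
        · obtain ⟨rfl, rfl, rfl⟩ := by simpa using hx
          exact ⟨leF t s, rfl, (codes_listEncode_le ArithRel.le ![t, s]).symm⟩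
    | @step y z x _ _ h ihy ihz =>
      obtain ⟨k₁, τ₁, l₁⟩ := y
      obtain ⟨k₂, τ₂, l₂⟩ := z
      obtain ⟨φ, rfl, rfl⟩ := ihy rfl
      rcases h with ⟨h, rfl⟩ | ⟨k', h, rfl⟩
      · obtain rfl : k₂ = k₁ := h
        obtain ⟨ψ, rfl, rfl⟩ := ihz rfl
        obtain ⟨rfl, rfl, rfl⟩ := by simpa using hx
        exact ⟨.imp φ ψ, rfl, (codes_listEncode_imp φ ψ).symm⟩
      · obtain rfl : k₁ = k' + 1 := h
        obtain ⟨rfl, rfl, rfl⟩ := by simpa using hx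
        exact ⟨.all φ, rfl, (codes_listEncode_all φ).symm⟩
  · rintro ⟨φ, rfl, rfl⟩
    induction φ with
    | falsum => exact .base (Or.inl ⟨_, by rw [codes_listEncode_falsum]; rfl⟩)
    | equal t s =>
      exact .base (Or.inr ⟨((_, trTerm t, _), (_, trTerm s, _)), ⟨gen_term_iff.2 ⟨t, rfl, rfl⟩,
        gen_term_iff.2 ⟨s, rfl, rfl⟩, rfl⟩, Or.inl (by rw [codes_listEncode_equal]; rfl)⟩)
    | rel R ts =>
      cases R
      exact .base (Or.inr ⟨((_, trTerm (ts 0), _), (_, trTerm (ts 1), _)),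
        ⟨gen_term_iff.2 ⟨_, rfl, rfl⟩, gen_term_iff.2 ⟨_, rfl, rfl⟩, rfl⟩,
        Or.inr (congrArg (fun l => (_, _, l)) (codes_listEncode_le ArithRel.le ts))⟩)
    | imp φ ψ ihφ ihψ =>
      exact .step ihφ ihψ (Or.inl ⟨rfl, by rw [codes_listEncode_imp]; rfl⟩)
    | all φ ih => exact .step ih ih (Or.inr ⟨_, rfl, by rw [codes_listEncode_all]; rfl⟩)

theorem godel_injective {k : ℕ} :
    Function.Injective (godel : LA.BoundedFormula Empty k → ℕ) := fun φ ψ h => by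
  have := BoundedFormula.listEncode_sigma_injective (a₁ := ⟨k, φ⟩) (a₂ := ⟨k, ψ⟩)
    (Encodable.encode_injective h)
  simpa using this

/-- The trees of the axioms of a `Σₙ`-definable theory form a `Σₙ`-definable set. -/
theorem sd_axioms {n : ℕ} {T : LA.Theory} (h : SigmaDefinable (n + 1) (axiomCodes T)) :
    SD n fun t => ∃ ψ ∈ T, t = tr ψ := by
  have hT : SD n fun m => m ∈ axiomCodes T := by
    obtain ⟨Ψ, hΨ, hd⟩ := h
    refine .of_sigmaSet ⟨Ψ, hΨ, fun v => ?_⟩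
    refine Iff.trans (iff_of_eq (congrArg _ ?_)) (hd (v 0)).symm
    exact funext fun i => by rw [Subsingleton.elim i 0]; rfl
  refine SD.congr (SD.ex (P := fun t l => Gen FormulaBase FormulaStep (0, t, l) ∧
    Encodable.encode l ∈ axiomCodes T) (.and ((sd_gen_formula n).comp
      (f := fun p : Tr × List ℕ => (0, p.1, p.2)) (by fun_prop))
      (hT.comp (f := fun p : Tr × List ℕ => Encodable.encode p.2) (by fun_prop)))) fun t => ?_
  constructor
  · rintro ⟨l, hl, ψ, hψ, hg⟩
    obtain ⟨φ, rfl, rfl⟩ := gen_formula_iff.1 hl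
    rw [encode_codes] at hg
    obtain rfl := godel_injective hg
    exact ⟨ψ, hψ, rfl⟩
  · rintro ⟨ψ, hψ, rfl⟩
    exact ⟨codes ψ.listEncode, gen_formula_iff.2 ⟨ψ, rfl, rfl⟩, ψ, hψ, (encode_codes _).symm⟩

/-! ### Diagonalization -/

/-- The sentence `∀ x, x ≠ m̄ ∨ ψ(x)`. -/
def instSentence (ψ : LA.BoundedFormula Empty 1) (m : ℕ) : LA.Sentence :=
  (((&0 =' numeralT (Empty ⊕ Fin 1) m) ⟹ ⊥) ⊔ ψ).all

theorem IsPi.instSentence {n : ℕ} {ψ : LA.BoundedFormula Empty 1} (h : IsPi (n + 1) ψ) (m : ℕ) :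
    IsPi (n + 1) (instSentence ψ m) :=
  .all (.sup (Delta0.isPi (.imp (.equal _ _) .falsum)) h)

theorem realize_instSentence {ψ : LA.BoundedFormula Empty 1} {m : ℕ} :
    ℕ ⊨ instSentence ψ m ↔ ψ.Realize (fun e => Empty.elim e) fun _ : Fin 1 => m := by
  have hs (v : Fin 0 → ℕ) (a : ℕ) : Fin.snoc (α := fun _ => ℕ) v a = fun _ : Fin 1 => a :=
    funext fun i => by rw [Fin.fin_one_eq_zero i]; rfl
  have he (e e' : Empty → ℕ) (v : Fin 1 → ℕ) (h : ψ.Realize e v) : ψ.Realize e' v :=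
    Subsingleton.elim e e' ▸ h
  simp only [instSentence, Sentence.Realize, Formula.Realize, realize_all, realize_sup,
    realize_imp, realize_bdEqual, realize_bot, realize_numeralT, stdElt_nat, hs,
    Function.comp_apply, Term.realize_var, Sum.elim_inr]
  exact ⟨fun h => he _ _ _ ((h m).resolve_left fun h => h rfl), fun h a =>
    (em (a = m)).elim (fun ha => Or.inr (ha ▸ he _ _ _ h)) Or.inl⟩

/-- The tree of the numeral of `m`. -/
def numeralTr : ℕ → Tr
  | 0 => node 0 (leaf 0) (leaf 0)
  | m + 1 => node 1 (numeralTr m) (leaf 0)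

theorem trTerm_numeralT {k : ℕ} (m : ℕ) : trTerm (numeralT (Empty ⊕ Fin k) m) = numeralTr m := by
  induction m with
  | zero => rfl
  | succ m ih => exact congrArg (node 1 · (leaf 0)) ih

theorem primrec_numeralTr : Primrec numeralTr := by
  refine (Primrec.nat_rec₁ (f := fun _ t => node 1 t (leaf 0)) (node 0 (leaf 0) (leaf 0))
    (primrec_node (.const 1) .snd (.const _))).of_eq fun m => ?_
  induction m with
  | zero => rfl
  | succ m ih => exact congrArg (node 1 · (leaf 0)) ih

/-- The tree of `instSentence ψ m`, as a function of the tree of `ψ` and of `m`. -/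
def instTr (t : Tr) (m : ℕ) : Tr :=
  node 4 (node 2 (node 2 (node 2 (node 0 (leaf 0) (numeralTr m)) (leaf 0)) (leaf 0)) t) (leaf 0)

theorem tr_instSentence (ψ : LA.BoundedFormula Empty 1) (m : ℕ) :
    tr (instSentence ψ m) = instTr (tr ψ) m := by
  rw [instTr, ← trTerm_numeralT (k := 1)]
  rfl

/-- For a `Σₙ`-definable theory `T` there is a `Πₙ`-sentence which is true iff it is unprovable
in `T`. -/
theorem exists_true_iff_not_proves {n : ℕ} {T : LA.Theory}
    (h : SigmaDefinable (n + 1) (axiomCodes T)) :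
    ∃ γ : LA.Sentence, IsPi (n + 1) γ ∧ (ℕ ⊨ γ ↔ ¬ Proves T γ) := by
  have hD : SD n fun m : ℕ => Prov (fun t => ∃ ψ ∈ T, t = tr ψ) (instTr (dec m) m) := by
    refine (sd_prov (sd_axioms h)).comp (f := fun m => instTr (dec m) m) ?_
    have := primrec_numeralTr
    have := primrec_dec
    unfold instTr
    fun_prop
  obtain ⟨φ, hφ, H⟩ := hD.sigmaSet_nat
  obtain ⟨ψ, hψ, Hψ⟩ := hφ.exists_dual
  refine ⟨instSentence ψ (enc (tr ψ)), hψ.instSentence _, ?_⟩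
  rw [realize_instSentence, Hψ, H, proves_iff_prov, tr_instSentence]
  beta_reduce
  rw [dec_enc]

/-- **Corollary 2.8.** No `Σₙ`-definable (`n > 0`) extension of `Q` that is
consistent with `Πₙ-Th(ℕ)` is `Πₙ`-deciding. -/
theorem sigmaDefinable_consistentWithPiTh_not_piDeciding (n : ℕ) (hn : 0 < n)
    (T : LA.Theory) (hQ : ExtendsQ T)
    (hdef : SigmaDefinable n (axiomCodes T))
    (hcon : Consistent (T ∪ PiTh n)) :
    ∃ γ : LA.Sentence, IsPi n γ ∧ ¬ Proves T γ ∧ ¬ Proves T (∼γ) := by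
  obtain ⟨n, rfl⟩ : ∃ k, n = k + 1 := ⟨n - 1, by omega⟩
  obtain ⟨γ, hγ, hiff⟩ := exists_true_iff_not_proves hdef
  obtain ⟨M, -⟩ : ∃ M : (T ∪ PiTh (n + 1)).ModelType, ¬ M ⊨ (⊥ : LA.Sentence) := by
    simpa only [Consistent, Proves, Theory.models_sentence_iff, not_forall] using hcon
  have hT : M ⊨ T := Theory.Model.mono M.is_model Set.subset_union_left
  have hPi : ∀ γ ∈ PiTh (n + 1), M ⊨ γ := fun γ h => M.is_model.realize_of_mem γ (Or.inr h)
  have hM : ModelsQ M := modelsQ_of_realize fun φ h => (hQ φ h).realize_sentence M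
  have htrue : Proves T γ → ℕ ⊨ γ := fun hp => by
    by_contra hfalse
    obtain ⟨σ, hσ, H⟩ := hγ.exists_dual
    have := hM.realize_of_isSigma hσ hPi default _ _ ((H ℕ _ _).2 hfalse)
    refine (H M _ _).1 this ?_
    convert hp.realize_sentence M
    exact iff_of_eq (congrArg₂ _ (Subsingleton.elim _ _) (Subsingleton.elim _ _))
  have hnot : ¬ Proves T γ := fun hp => hiff.1 (htrue hp) hp
  refine ⟨γ, hγ, hnot, fun hp => ?_⟩
  exact (Sentence.realize_not M).1 (hp.realize_sentence M) (hPi γ ⟨hγ, hiff.2 hnot⟩)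

end GRNonRE
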